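/- arXiv:2206.00883 — 2 statements merged into one kernel-verified Lean document; each statement's English description precedes it below -/
import Mathlib

section
/- For every Schwartz function f on ℍⁿ and every (z,t) ∈ ℍⁿ, the inversion formula f(z,t) = ∫_Ω ∫_{ℂⁿ} f̂(a,w) e_a((−w,0)·(z,t)) dw dν(a) holds; explicitly, f(z,t) = (2π)^{−2n−1} ∫_ℝ Σ_{k=0}^∞ ( ∫_{ℂⁿ} f̂((λ,(2k+n)|λ|), w) e^{iλ(t−(1/2)Im(w·z̄))} φ_{k,λ}(z−w) dw ) |λ|^{2n} dλ. -/
open MeasureTheory Complex Real Filter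

noncomputable section

/-- ℂⁿ with its Euclidean (Hilbert space) structure. -/
abbrev Cn (n : ℕ) := EuclideanSpace ℂ (Fin n)

instance (n : ℕ) : MeasurableSpace (Cn n) := borel _
instance (n : ℕ) : BorelSpace (Cn n) := ⟨rfl⟩
instance (n : ℕ) : InnerProductSpace ℝ (Cn n) := InnerProductSpace.rclikeToReal ℂ (Cn n)

/-- The Heisenberg group ℍⁿ = ℂⁿ × ℝ (as a measure space with Lebesgue/Haar measure). -/
abbrev Hn (n : ℕ) := Cn n × ℝ

/-- Im (z · w̄) = Im (∑ⱼ zⱼ conj wⱼ). -/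
def imZW {n : ℕ} (z w : Cn n) : ℝ := (∑ j, z j * (starRingEnd ℂ) (w j)).im

/-- The λ-twisted convolution F ∗_λ G (z) = ∫ F(z−w) G(w) e^{(i/2)λ Im(z·w̄)} dw. -/
def twConv (n : ℕ) (lam : ℝ) (F G : Cn n → ℂ) (z : Cn n) : ℂ :=
  ∫ w : Cn n, F (z - w) * G w * Complex.exp
    (Complex.I / 2 * (lam : ℂ) * ((imZW z w : ℝ) : ℂ))

/-- The inverse Fourier transform in the central variable, f^λ(z) = ∫ e^{iλt} f(z,t) dt. -/
def fLam (n : ℕ) (f : Hn n → ℂ) (lam : ℝ) (z : Cn n) : ℂ :=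
  ∫ t : ℝ, Complex.exp (Complex.I * (lam : ℂ) * (t : ℂ)) * f (z, t)

/-- The Laguerre polynomial of type m−1:
L_k^{m−1}(t) = ∑_{j=0}^k binom(k+m−1, k−j) (−t)^j / j!. -/
def lagPoly (m k : ℕ) (t : ℝ) : ℝ :=
  ∑ j ∈ Finset.range (k + 1), ((k + m - 1).choose (k - j) : ℝ) * (-t) ^ j / (Nat.factorial j)

/-- The Laguerre function φ_{k,λ}^{m−1}(z) = L_k^{m−1}(|λ||z|²/2) e^{−|λ||z|²/4} on ℂ^m. -/
def lagFun (m k : ℕ) (lam : ℝ) (z : Cn m) : ℝ :=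
  lagPoly m k (|lam| * ‖z‖ ^ 2 / 2) * Real.exp (-(|lam| * ‖z‖ ^ 2 / 4))

/-- The Strichartz Fourier transform f̂(a,z) = f^{−λ} ∗_{−λ} φ_{k,λ}(z)
at the point a = (λ, (2k+n)|λ|) of the ray R_k. -/
def stri (n : ℕ) (f : Hn n → ℂ) (k : ℕ) (lam : ℝ) (z : Cn n) : ℂ :=
  twConv n (-lam) (fLam n f (-lam)) (fun w => ((lagFun n k lam w : ℝ) : ℂ)) z

/-- The normalizing constant k!(n−1)!/(k+n−1)!. -/
def normC (n k : ℕ) : ℝ :=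
  (Nat.factorial k * Nat.factorial (n - 1) : ℝ) / (Nat.factorial (k + n - 1))

/-- The Bessel kernel J_{n−1}(s)/s^{n−1}, extended by its limiting value
1/(2^{n−1}(n−1)!) at s = 0, given by its power series. -/
def besselKer (n : ℕ) (s : ℝ) : ℝ :=
  ∑' m : ℕ, (-1 : ℝ) ^ m / (Nat.factorial m * Nat.factorial (m + n - 1)) *
    s ^ (2 * m) / 2 ^ (2 * m + n - 1)

/-- The Strichartz Fourier transform f̂((0,τ),z) on the limiting ray R_∞. -/
def striLim (n : ℕ) (f : Hn n → ℂ) (z : Cn n) (τ : ℝ) : ℂ :=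
  ((Nat.factorial (n - 1) * 2 ^ (n - 1) : ℝ) : ℂ) *
    ∫ w : Cn n, fLam n f 0 (z - w) * ((besselKer n (Real.sqrt τ * ‖w‖) : ℝ) : ℂ)

/-- The Heisenberg fan Ω ⊆ ℝ²: union of the rays R_k, k ∈ ℕ, and the limiting ray R_∞. -/
def fan (n : ℕ) : Set (ℝ × ℝ) :=
  {a | (∃ k : ℕ, a.1 ≠ 0 ∧ a.2 = (2 * k + n) * |a.1|) ∨ (a.1 = 0 ∧ 0 ≤ a.2)}

open scoped Classical in
/-- The index k of the ray R_k through a point of the fan (junk value otherwise). -/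
def fanK (n : ℕ) (a : ℝ × ℝ) : ℕ :=
  if h : ∃ k : ℕ, a.2 = (2 * k + n) * |a.1| then h.choose else 0

/-- The normalized Strichartz Fourier transform f̃(a,z), as a function of a ∈ Ω. -/
def striNorm (n : ℕ) (f : Hn n → ℂ) (z : Cn n) (a : ℝ × ℝ) : ℂ :=
  if a.1 = 0 then striLim n f z a.2
  else ((normC n (fanK n a) : ℝ) : ℂ) * stri n f (fanK n a) a.1 z

/-- The Plancherel measure ν on the Heisenberg fan:
∫ φ dν = (2π)^{−2n−1} ∫_ℝ (∑_k φ(λ,(2k+n)|λ|)) |λ|^{2n} dλ. -/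
def fanMeasure (n : ℕ) : Measure (ℝ × ℝ) :=
  (ENNReal.ofReal ((2 * π) ^ (2 * n + 1)))⁻¹ •
    Measure.sum (fun k : ℕ =>
      Measure.map (fun lam : ℝ => (lam, (2 * k + n) * |lam|))
        (volume.withDensity fun lam => ENNReal.ofReal (|lam| ^ (2 * n))))

/-- A function on ℍⁿ is radial if it is invariant under the action of the unitary group U(n). -/
def IsRadial (n : ℕ) (g : Hn n → ℂ) : Prop :=
  ∀ (U : Cn n ≃ₗᵢ[ℂ] Cn n) (x : Hn n), g (U x.1, x.2) = g x

/-- The k-th Laguerre coefficient R_k(λ, f) = (k!(n−1)!/(k+n−1)!) ∫ f^λ(w) φ_{k,λ}(w) dw. -/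
def lagCoef (n : ℕ) (k : ℕ) (lam : ℝ) (f : Hn n → ℂ) : ℂ :=
  ((normC n k : ℝ) : ℂ) * ∫ w : Cn n, fLam n f lam w * ((lagFun n k lam w : ℝ) : ℂ)

/-- The Gelfand (spherical Fourier) transform of a radial function on ℍ^m, evaluated at
(λ, (2j+m)|λ|). -/
def gelfand (m : ℕ) (h : Hn m → ℂ) (lam : ℝ) (j : ℕ) : ℂ :=
  ((normC m j : ℝ) : ℂ) *
    ∫ x : Hn m, h x * Complex.exp (Complex.I * (lam : ℂ) * (x.2 : ℂ)) *
      ((lagFun m j lam x.1 : ℝ) : ℂ)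

/-- The group convolution on ℍⁿ: f∗g(x) = ∫ f(x·y⁻¹) g(y) dy. -/
def hConv (n : ℕ) (f g : Hn n → ℂ) (x : Hn n) : ℂ :=
  ∫ y : Hn n, f (x.1 - y.1, x.2 - y.2 - imZW x.1 y.1 / 2) * g y

/-- P is a bigraded solid harmonic of degree (p,q) on ℂⁿ: P(z) = ∑_{|α|=p,|β|=q} c_{αβ} z^α z̄^β,
harmonic as a function on ℝ^{2n} (the harmonicity Δ P = 0 is expressed by the equivalent
algebraic condition on the coefficients). -/
def IsBigradedSolidHarmonic (n p q : ℕ) (P : Cn n → ℂ) : Prop :=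
  ∃ c : (Fin n → ℕ) → (Fin n → ℕ) → ℂ,
    (∀ z : Cn n, P z =
      ∑ α ∈ Finset.Nat.antidiagonalTuple n p, ∑ β ∈ Finset.Nat.antidiagonalTuple n q,
        c α β * (∏ j, z j ^ α j) * ∏ j, (starRingEnd ℂ) (z j) ^ β j) ∧
    (∀ γ δ : Fin n → ℕ,
      ∑ j : Fin n, (((γ j + 1) * (δ j + 1) : ℕ) : ℂ) *
        c (Function.update γ j (γ j + 1)) (Function.update δ j (δ j + 1)) = 0)

/-- The physicists' Hermite polynomial H_m(x) = (−1)^m e^{x²} (d/dx)^m e^{−x²}. -/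
def physHermite (m : ℕ) (x : ℝ) : ℝ :=
  (-1 : ℝ) ^ m * Real.exp (x ^ 2) * iteratedDeriv m (fun y => Real.exp (-(y ^ 2))) x

/-- The normalized Hermite function h_m(x) = (2^m m! √π)^{−1/2} H_m(x) e^{−x²/2}. -/
def hermiteFun (m : ℕ) (x : ℝ) : ℝ :=
  (Real.sqrt (2 ^ m * (Nat.factorial m) * Real.sqrt π))⁻¹ * physHermite m x *
    Real.exp (-(x ^ 2) / 2)

/-- The scaled Hermite function Φ_α^λ(x) = |λ|^{n/4} ∏ⱼ h_{αⱼ}(√|λ| xⱼ). -/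
def scaledHermite (n : ℕ) (lam : ℝ) (α : Fin n → ℕ) (x : Fin n → ℝ) : ℝ :=
  |lam| ^ ((n : ℝ) / 4) * ∏ j, hermiteFun (α j) (Real.sqrt |lam| * x j)

/-- The Schrödinger representation: π_λ(z,t)φ(ξ) = e^{iλt} e^{iλ(x·ξ+(1/2)x·y)} φ(ξ+y),
z = x+iy. -/
def schrodinger (n : ℕ) (lam : ℝ) (zt : Hn n) (φ : (Fin n → ℝ) → ℂ) (ξ : Fin n → ℝ) : ℂ :=
  Complex.exp (Complex.I * (lam : ℂ) * (zt.2 : ℂ)) *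
    Complex.exp (Complex.I * (lam : ℂ) *
      (((∑ j, (zt.1 j).re * ξ j) + (∑ j, (zt.1 j).re * (zt.1 j).im) / 2 : ℝ) : ℂ)) *
    φ (fun j => ξ j + (zt.1 j).im)

/-- The group Fourier transform f̂(λ)φ = ∫ f(z,t) π_λ(z,t)φ dz dt. -/
def groupFT (n : ℕ) (f : Hn n → ℂ) (lam : ℝ) (φ : (Fin n → ℝ) → ℂ) (ξ : Fin n → ℝ) : ℂ :=
  ∫ x : Hn n, f x * schrodinger n lam x φ ξ

theorem abs_lagPoly_le (m k : ℕ) {t : ℝ} (ht : 0 ≤ t) :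
    |lagPoly m k t| ≤ lagPoly m k (-t) := by
  unfold lagPoly
  refine (Finset.abs_sum_le_sum_abs _ _).trans (Finset.sum_le_sum fun j _ => ?_)
  rw [abs_div, abs_mul, abs_pow, abs_neg, abs_of_nonneg ht, neg_neg]
  simp

theorem continuous_lagPoly (m k : ℕ) : Continuous (lagPoly m k) := by
  unfold lagPoly
  fun_prop

theorem lagPoly_zero_right (m k : ℕ) : lagPoly m k 0 = ((k + m - 1).choose k : ℝ) := by
  unfold lagPoly
  rw [Finset.sum_eq_single 0]
  · simp
  · intro j _ hj
    simp [hj]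
  · simp

theorem succ_mul_lagPoly_succ (m k : ℕ) (t : ℝ) :
    ((k + 1 : ℕ) : ℝ) * lagPoly (m + 1) (k + 1) t =
      ((m + 1 : ℕ) : ℝ) * lagPoly (m + 2) k t - t * lagPoly (m + 3) k t := by
  have coef (j : ℕ) (hj : j ≤ k) : ((k + 1 : ℕ) : ℝ) * ((k + 1 + m).choose (k + 1 - j) : ℝ) =
      (m + 1 : ℕ) * ((k + m + 1).choose (k - j) : ℝ) +
        j * ((k + m + 2).choose (k + 1 - j) : ℝ) := by
    obtain ⟨i, rfl⟩ := Nat.exists_eq_add_of_le hj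
    have e1 : j + i + 1 - j = i + 1 := by omega
    have e2 : j + i - j = i := by omega
    rw [e1, e2, show j + i + 1 + m = j + i + m + 1 by ring, Nat.choose_succ_succ (j + i + m + 1) i]
    have h := Nat.choose_succ_right_eq (j + i + m + 1) i
    rw [show j + i + m + 1 - i = j + m + 1 by omega] at h
    have h' : ((j + i + m + 1).choose (i + 1) : ℝ) * (i + 1) =
      ((j + i + m + 1).choose i : ℝ) * (j + m + 1) := by exact_mod_cast h
    push_cast
    linear_combination h'
  unfold lagPoly
  rw [Finset.mul_sum, Finset.mul_sum, Finset.mul_sum, Finset.sum_range_succ]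
  have e : ∑ j ∈ Finset.range (k + 1), t * (((k + (m + 3) - 1).choose (k - j) : ℝ) * (-t) ^ j /
      (Nat.factorial j)) = - ∑ j ∈ Finset.range (k + 2),
        (j : ℝ) * ((k + m + 2).choose (k + 1 - j) : ℝ) * (-t) ^ j / (Nat.factorial j) := by
    rw [Finset.sum_range_succ' _ (k + 1)]
    simp only [CharP.cast_eq_zero, zero_mul, zero_div, add_zero]
    rw [← Finset.sum_neg_distrib]
    refine Finset.sum_congr rfl fun j _ => ?_
    rw [show k + 1 - (j + 1) = k - j by omega, show k + (m + 3) - 1 = k + m + 2 by omega,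
      Nat.factorial_succ]
    push_cast
    field_simp
    ring
  rw [e, sub_neg_eq_add, Finset.sum_range_succ _ (k + 1), ← add_assoc (Finset.sum _ _),
    ← Finset.sum_add_distrib]
  congr 1
  · refine Finset.sum_congr rfl fun j hj => ?_
    have := coef j (by simpa [Nat.lt_succ_iff] using hj)
    rw [show k + 1 + (m + 1) - 1 = k + 1 + m by omega, show k + (m + 2) - 1 = k + m + 1 by omega]
    linear_combination ((-t) ^ j / (Nat.factorial j)) * this
  · simp
    ring

/-- The terms of the double series behind the Laguerre generating function. -/
theorem hasSum_laguerre_double (m : ℕ) (t : ℝ) {r : ℝ} (hr : |r| < 1) :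
    HasSum (fun p : ℕ × ℕ => ((p.1 + p.2 + m).choose p.1 : ℝ) * (-t) ^ p.2 / (Nat.factorial p.2) *
      r ^ (p.1 + p.2)) ((1 - r)⁻¹ ^ (m + 1) * Real.exp (-(t * r / (1 - r)))) := by
  have inner (t r : ℝ) (hr : |r| < 1) (j : ℕ) : HasSum (fun i : ℕ =>
      ((i + j + m).choose i : ℝ) * (-t) ^ j / (Nat.factorial j) * r ^ (i + j))
      ((1 - r)⁻¹ ^ (m + 1) * ((-(t * r / (1 - r))) ^ j / (Nat.factorial j))) := by
    have h := (hasSum_choose_mul_geometric_of_norm_lt_one (j + m) (r := r)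
      (by simpa using hr)).mul_left ((-t) ^ j / (Nat.factorial j) * r ^ j)
    have h1 : 1 - r ≠ 0 := by
      have := (abs_lt.mp hr).2
      linarith
    convert! h using 1
    · ext i
      rw [← add_assoc, Nat.choose_symm_of_eq_add (show i + j + m = i + (j + m) by ring), pow_add]
      ring
    · rw [← neg_div, div_pow, ← neg_mul, mul_pow, inv_pow]
      rw [show (1 - r) ^ (j + m + 1) = (1 - r) ^ j * (1 - r) ^ (m + 1) by ring]
      field_simp
  have outer (t r : ℝ) : HasSum (fun j : ℕ =>
      (1 - r)⁻¹ ^ (m + 1) * ((-(t * r / (1 - r))) ^ j / (Nat.factorial j)))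
      ((1 - r)⁻¹ ^ (m + 1) * Real.exp (-(t * r / (1 - r)))) := by
    refine HasSum.mul_left _ ?_
    rw [Real.exp_eq_exp_ℝ]
    exact NormedSpace.expSeries_div_hasSum_exp _
  have hsum : Summable (fun p : ℕ × ℕ => ((p.2 + p.1 + m).choose p.2 : ℝ) * (-t) ^ p.1 /
      (Nat.factorial p.1) * r ^ (p.2 + p.1)) := by
    apply Summable.of_norm
    have e : (fun p : ℕ × ℕ => ‖((p.2 + p.1 + m).choose p.2 : ℝ) * (-t) ^ p.1 /
      (Nat.factorial p.1) * r ^ (p.2 + p.1)‖) = fun p : ℕ × ℕ =>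
        ((p.2 + p.1 + m).choose p.2 : ℝ) * (-(-|t|)) ^ p.1 / (Nat.factorial p.1) *
          |r| ^ (p.2 + p.1) := by
      ext p
      simp
    rw [e, summable_prod_of_nonneg]
    · refine ⟨fun j => (inner (-|t|) |r| (by simpa using hr) j).summable, ?_⟩
      convert (outer (-|t|) |r|).summable using 2 with j
      exact (inner (-|t|) |r| (by simpa using hr) j).tsum_eq
    · intro p
      simp only [neg_neg, Pi.zero_apply]
      positivity
  have h := hsum.hasSum
  have h2 := h.prod_fiberwise (fun j => inner t r hr j)
  rw [← (outer t r).unique h2] at h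
  exact (Equiv.prodComm ℕ ℕ).hasSum_iff.mp h

/-- Generating function of the Laguerre polynomials. -/
theorem hasSum_lagPoly (m : ℕ) (t : ℝ) {r : ℝ} (hr : |r| < 1) :
    HasSum (fun k : ℕ => lagPoly (m + 1) k t * r ^ k)
      ((1 - r)⁻¹ ^ (m + 1) * Real.exp (-(t * r / (1 - r)))) := by
  have h := Finset.HasAntidiagonal.sigmaAntidiagonalEquivProd.hasSum_iff.mpr
    (hasSum_laguerre_double m t hr)
  have h2 := h.sigma (fun k => hasSum_fintype _)
  convert! h2 using 1
  ext k
  rw [Finset.univ_eq_attach]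
  simp only [Function.comp_apply, Finset.HasAntidiagonal.sigmaAntidiagonalEquivProd_apply]
  rw [Finset.sum_attach (Finset.HasAntidiagonal.antidiagonal k) (fun p => ((p.1 + p.2 + m).choose p.1 : ℝ) *
    (-t) ^ p.2 / (Nat.factorial p.2) * r ^ (p.1 + p.2)),
    Finset.Nat.sum_antidiagonal_eq_sum_range_succ_mk, lagPoly, Finset.sum_mul,
    ← Finset.sum_range_reflect]
  refine Finset.sum_congr rfl fun j hj => ?_
  have hj : j ≤ k := by simpa [Nat.lt_succ_iff] using hj
  rw [show k + 1 - 1 - j = k - j by omega, show k - (k - j) = j by omega,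
    show j + (k - j) = k by omega, show k + (m + 1) - 1 = k + m by omega]

/-- Generating function of the Laguerre polynomials weighted by the degree. -/
theorem hasSum_natCast_mul_lagPoly (m : ℕ) (t : ℝ) {r : ℝ} (hr : |r| < 1) :
    HasSum (fun k : ℕ => (k : ℝ) * lagPoly (m + 1) k t * r ^ k)
      (((m + 1 : ℕ) * (r / (1 - r)) - t * r / (1 - r) ^ 2) *
        ((1 - r)⁻¹ ^ (m + 1) * Real.exp (-(t * r / (1 - r))))) := by
  have h := ((((hasSum_lagPoly (m + 1) t hr).mul_left ((m + 1 : ℕ) : ℝ)).sub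
    ((hasSum_lagPoly (m + 2) t hr).mul_left t)).mul_left r)
  rw [← hasSum_nat_add_iff' 1]
  have h1 : 1 - r ≠ 0 := by
    have := (abs_lt.mp hr).2
    linarith
  convert! h using 1
  · ext k
    rw [succ_mul_lagPoly_succ, pow_succ]
    ring
  · simp
    field_simp
    ring

section Laguerre
variable {V : Type*} [NormedAddCommGroup V]

/-- The Laguerre function with parameter `κ = |λ|` on a normed space. -/
def laguerreFun (n k : ℕ) (κ : ℝ) (y : V) : ℝ :=
  lagPoly n k (κ * ‖y‖ ^ 2 / 2) * Real.exp (-(κ * ‖y‖ ^ 2 / 4))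

/-- The generating function `∑ₖ rᵏ φₖ`, a Gaussian (Mehler kernel). -/
def mehlerFun (n : ℕ) (κ r : ℝ) (y : V) : ℝ :=
  (1 - r)⁻¹ ^ n * Real.exp (-(κ / 4 * ((1 + r) / (1 - r))) * ‖y‖ ^ 2)

theorem continuous_laguerreFun (n k : ℕ) (κ : ℝ) :
    Continuous (laguerreFun n k κ : V → ℝ) := by
  unfold laguerreFun
  have := continuous_lagPoly n k
  fun_prop

theorem continuous_mehlerFun (n : ℕ) (κ r : ℝ) :
    Continuous (mehlerFun n κ r : V → ℝ) := by
  unfold mehlerFun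
  fun_prop

theorem laguerreFun_neg (n k : ℕ) (κ : ℝ) (y : V) :
    laguerreFun n k κ (-y) = laguerreFun n k κ y := by
  simp [laguerreFun]

theorem laguerreFun_zero (n k : ℕ) (κ : ℝ) :
    laguerreFun n k κ (0 : V) = ((k + n - 1).choose k : ℝ) := by
  simp [laguerreFun, lagPoly_zero_right]

theorem one_sub_pos_of_abs_lt {r : ℝ} (hr : |r| < 1) : 0 < 1 - r := by
  linarith [(abs_lt.mp hr).2]

theorem one_add_pos_of_abs_lt {r : ℝ} (hr : |r| < 1) : 0 < 1 + r := by
  linarith [(abs_lt.mp hr).1]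

theorem hasSum_laguerreFun {n : ℕ} (hn : 1 ≤ n) (κ : ℝ) (y : V) {r : ℝ} (hr : |r| < 1) :
    HasSum (fun k : ℕ => r ^ k * laguerreFun n k κ y) (mehlerFun n κ r y) := by
  obtain ⟨m, rfl⟩ := Nat.exists_eq_add_of_le' hn
  have h := (hasSum_lagPoly m (κ * ‖y‖ ^ 2 / 2) hr).mul_right (Real.exp (-(κ * ‖y‖ ^ 2 / 4)))
  have h1 := (one_sub_pos_of_abs_lt hr).ne'
  convert! h using 1
  · ext k
    rw [laguerreFun]
    ring
  · rw [mul_assoc, ← Real.exp_add, mehlerFun]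
    congr 2
    field_simp
    ring

theorem hasSum_degree_mul_laguerreFun {n : ℕ} (hn : 1 ≤ n) (κ : ℝ) (y : V) {r : ℝ}
    (hr : |r| < 1) :
    HasSum (fun k : ℕ => r ^ k * ((2 * k + n) * laguerreFun n k κ y))
      ((n * ((1 + r) / (1 - r)) - κ * ‖y‖ ^ 2 * (r / (1 - r) ^ 2)) * mehlerFun n κ r y) := by
  obtain ⟨m, rfl⟩ := Nat.exists_eq_add_of_le' hn
  have h := ((hasSum_natCast_mul_lagPoly m (κ * ‖y‖ ^ 2 / 2) hr).mul_right
    (Real.exp (-(κ * ‖y‖ ^ 2 / 4)))).mul_left 2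
  have h2 := (hasSum_laguerreFun hn κ y hr).mul_left ((m + 1 : ℕ) : ℝ)
  have h1 := (one_sub_pos_of_abs_lt hr).ne'
  convert! h.add h2 using 1
  · ext k
    rw [laguerreFun]
    ring
  · rw [mul_assoc _ _ (Real.exp (-(κ * ‖y‖ ^ 2 / 4))),
      mul_assoc _ _ (Real.exp (-(κ * ‖y‖ ^ 2 / 4))), ← Real.exp_add]
    have e : (1 - r)⁻¹ ^ (m + 1) * Real.exp (-(κ * ‖y‖ ^ 2 / 2 * r / (1 - r)) +
        -(κ * ‖y‖ ^ 2 / 4)) = mehlerFun (m + 1) κ r y := by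
      rw [mehlerFun]
      congr 2
      field_simp
      ring
    rw [e]
    push_cast
    field_simp
    ring

/-- A positive majorant of the Laguerre function. -/
def laguerreMajorant (n k : ℕ) (κ : ℝ) (y : V) : ℝ :=
  lagPoly n k (-(κ * ‖y‖ ^ 2 / 2)) * Real.exp (-(κ * ‖y‖ ^ 2 / 4))

theorem abs_laguerreFun_le_majorant (n k : ℕ) {κ : ℝ} (hκ : 0 ≤ κ) (y : V) :
    |laguerreFun n k κ y| ≤ laguerreMajorant n k κ y := by
  rw [laguerreFun, laguerreMajorant, abs_mul, Real.abs_exp]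
  gcongr
  exact abs_lagPoly_le _ _ (by positivity)

theorem hasSum_laguerreMajorant {n : ℕ} (hn : 1 ≤ n) (κ : ℝ) (y : V) {r : ℝ} (hr : |r| < 1) :
    HasSum (fun k : ℕ => r ^ k * laguerreMajorant n k κ y)
      ((1 - r)⁻¹ ^ n * Real.exp (-(κ / 4 * ((1 - 3 * r) / (1 - r))) * ‖y‖ ^ 2)) := by
  obtain ⟨m, rfl⟩ := Nat.exists_eq_add_of_le' hn
  have h := (hasSum_lagPoly m (-(κ * ‖y‖ ^ 2 / 2)) hr).mul_right
    (Real.exp (-(κ * ‖y‖ ^ 2 / 4)))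
  have h1 := (one_sub_pos_of_abs_lt hr).ne'
  convert! h using 1
  · ext k
    rw [laguerreMajorant]
    ring
  · rw [mul_assoc, ← Real.exp_add]
    congr 2
    field_simp
    ring

end Laguerre

section Gaussian
variable {V : Type*} [NormedAddCommGroup V] [InnerProductSpace ℝ V] [FiniteDimensional ℝ V]
  [MeasurableSpace V] [BorelSpace V]

theorem integrable_exp_neg_mul_sq_norm {a : ℝ} (ha : 0 < a) :
    Integrable (fun y : V => Real.exp (-a * ‖y‖ ^ 2)) := by
  have h := (GaussianFourier.integrable_cexp_neg_mul_sq_norm_add (V := V) (b := (a : ℂ))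
    (by simpa using ha) 0 0).norm
  refine h.congr (Eventually.of_forall fun y => ?_)
  simp only [zero_mul, add_zero, Complex.norm_exp]
  norm_cast

theorem integral_gaussian_twisted {n : ℕ} (hdim : Module.finrank ℝ V = 2 * n) (lam : ℝ)
    {a b : ℝ} (ha : 0 < a) (hb : 0 < b) {x w : V} (hxw : inner ℝ x w = 0) (hw : ‖w‖ = ‖x‖) :
    ∫ y : V, ((Real.exp (-a * ‖y‖ ^ 2) * Real.exp (-b * ‖x - y‖ ^ 2) : ℝ) : ℂ) *
      Complex.exp (-(Complex.I / 2 * lam * (inner ℝ w y : ℝ))) =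
    (((π / (a + b)) ^ n * Real.exp (-((a * b + lam ^ 2 / 16) / (a + b)) * ‖x‖ ^ 2) : ℝ) : ℂ) := by
  have hab : a + b ≠ 0 := (add_pos ha hb).ne'
  rw [← integral_add_right_eq_self _ ((b / (a + b)) • x)]
  have e (u : V) : ((Real.exp (-a * ‖u + (b / (a + b)) • x‖ ^ 2) *
      Real.exp (-b * ‖x - (u + (b / (a + b)) • x)‖ ^ 2) : ℝ) : ℂ) *
      Complex.exp (-(Complex.I / 2 * lam * (inner ℝ w (u + (b / (a + b)) • x) : ℝ))) =
      ((Real.exp (-(a * b / (a + b)) * ‖x‖ ^ 2) : ℝ) : ℂ) *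
        Complex.exp (-((a + b : ℝ) : ℂ) * ‖u‖ ^ 2 +
          -(Complex.I / 2 * lam) * (inner ℝ w u : ℝ)) := by
    have h1 : inner ℝ w (u + (b / (a + b)) • x) = inner ℝ w u := by
      rw [inner_add_right, inner_smul_right, real_inner_comm x w, hxw]; ring
    have h2 : x - (u + (b / (a + b)) • x) = -(u - (a / (a + b)) • x) := by
      have : (a / (a + b)) = 1 - b / (a + b) := by field_simp; ring
      rw [this, sub_smul, one_smul]; abel
    rw [h1, h2, norm_neg, ← Real.exp_add, @norm_add_sq_real, @norm_sub_sq_real, inner_smul_right,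
      inner_smul_right, norm_smul, norm_smul, Complex.exp_add]
    have h3 : -((a + b : ℝ) : ℂ) * ‖u‖ ^ 2 = ((-(a + b) * ‖u‖ ^ 2 : ℝ) : ℂ) := by push_cast; ring
    rw [h3, ← Complex.ofReal_exp,
      ← mul_assoc ((Real.exp _ : ℝ) : ℂ) ((Real.exp _ : ℝ) : ℂ), ← Complex.ofReal_mul, ← Real.exp_add]
    congr 3
    · rw [mul_pow, mul_pow, Real.norm_of_nonneg (by positivity),
        Real.norm_of_nonneg (by positivity)]
      field_simp
      ring
    · ring
  simp_rw [e]
  rw [integral_const_mul, GaussianFourier.integral_cexp_neg_mul_sq_norm_add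
    (by simpa using add_pos ha hb), hdim, hw]
  have h4 : ((2 * n : ℕ) : ℂ) / 2 = (n : ℂ) := by push_cast; ring
  rw [h4, Complex.cpow_natCast]
  have h5 : (-(Complex.I / 2 * lam)) ^ 2 * ‖x‖ ^ 2 / (4 * ((a + b : ℝ) : ℂ)) =
      ((-(lam ^ 2 / 16 / (a + b)) * ‖x‖ ^ 2 : ℝ) : ℂ) := by
    push_cast
    have : (a : ℂ) + b ≠ 0 := by exact_mod_cast hab
    field_simp
    rw [Complex.I_sq]
    ring
  rw [h5, ← Complex.ofReal_exp]
  norm_cast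
  rw [mul_left_comm, ← Real.exp_add]
  congr 2
  field_simp
  ring

theorem integral_mehlerFun_twisted {n : ℕ} (hdim : Module.finrank ℝ V = 2 * n) {lam : ℝ}
    (hlam : lam ≠ 0) {r s : ℝ} (hr : |r| < 1) (hs : |s| < 1) {x w : V} (hxw : inner ℝ x w = 0)
    (hw : ‖w‖ = ‖x‖) :
    ∫ y : V, ((mehlerFun n |lam| r y * mehlerFun n |lam| s (x - y) : ℝ) : ℂ) *
      Complex.exp (-(Complex.I / 2 * lam * (inner ℝ w y : ℝ))) =
    (((2 * π / |lam|) ^ n * mehlerFun n |lam| (r * s) x : ℝ) : ℂ) := by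
  have hκ : 0 < |lam| := abs_pos.mpr hlam
  have r1 := one_sub_pos_of_abs_lt hr
  have r2 := one_add_pos_of_abs_lt hr
  have s1 := one_sub_pos_of_abs_lt hs
  have s2 := one_add_pos_of_abs_lt hs
  have hrs : |r * s| < 1 := by
    rw [abs_mul]; exact mul_lt_one_of_nonneg_of_lt_one_left (abs_nonneg _) hr hs.le
  have q1 := one_sub_pos_of_abs_lt hrs
  have h := integral_gaussian_twisted hdim lam (a := |lam| / 4 * ((1 + r) / (1 - r)))
    (b := |lam| / 4 * ((1 + s) / (1 - s))) (by positivity) (by positivity) hxw hw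
  have e (y : V) : ((mehlerFun n |lam| r y * mehlerFun n |lam| s (x - y) : ℝ) : ℂ) *
      Complex.exp (-(Complex.I / 2 * lam * (inner ℝ w y : ℝ))) =
      (((1 - r)⁻¹ ^ n * (1 - s)⁻¹ ^ n : ℝ) : ℂ) *
      (((Real.exp (-(|lam| / 4 * ((1 + r) / (1 - r))) * ‖y‖ ^ 2) *
        Real.exp (-(|lam| / 4 * ((1 + s) / (1 - s))) * ‖x - y‖ ^ 2) : ℝ) : ℂ) *
      Complex.exp (-(Complex.I / 2 * lam * (inner ℝ w y : ℝ)))) := by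
    rw [← mul_assoc, ← Complex.ofReal_mul, mehlerFun, mehlerFun]
    congr 2
    ring
  simp_rw [e]
  rw [integral_const_mul, h, ← Complex.ofReal_mul]
  congr 1
  have q2 : (1 + r) * (1 - s) + (1 + s) * (1 - r) = 2 * (1 - r * s) := by ring
  have sum_eq : |lam| / 4 * ((1 + r) / (1 - r)) + |lam| / 4 * ((1 + s) / (1 - s)) =
      |lam| * (1 - r * s) / (2 * ((1 - r) * (1 - s))) := by
    field_simp
    linear_combination 2 * q2
  rw [sum_eq, mehlerFun, ← mul_assoc, ← mul_assoc, ← mul_pow, ← mul_pow, ← sq_abs lam,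
    ← mul_assoc ((2 * π / |lam|) ^ n), ← mul_pow (2 * π / |lam|)]
  congr 2
  · field_simp
  · congr 1
    field_simp
    ring
end Gaussian

section PowerSeries
variable {E : Type*} [NormedAddCommGroup E] [NormedSpace ℝ E]

/-- Uniqueness of the coefficients of a real power series. -/
theorem eq_of_hasSum_pow_smul {a b : ℕ → E} {g : ℝ → E} {ε : ℝ} (hε : 0 < ε)
    (ha : ∀ r : ℝ, |r| < ε → HasSum (fun k => r ^ k • a k) (g r))
    (hb : ∀ r : ℝ, |r| < ε → HasSum (fun k => r ^ k • b k) (g r)) : a = b := by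
  let P (d : ℕ → E) : FormalMultilinearSeries ℝ ℝ E :=
    fun k => ContinuousMultilinearMap.mkPiRing ℝ (Fin k) (d k)
  have hP (d : ℕ → E) (k : ℕ) : (P d).coeff k = d k := by
    simp [P, FormalMultilinearSeries.coeff]
  have key (d : ℕ → E) (hd : ∀ r : ℝ, |r| < ε → HasSum (fun k => r ^ k • d k) (g r)) :
      HasFPowerSeriesAt g (P d) 0 := by
    rw [hasFPowerSeriesAt_iff]
    filter_upwards [Metric.ball_mem_nhds (0 : ℝ) hε] with r hr
    simp only [hP, zero_add]
    exact hd r (by simpa using hr)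
  have := (key a ha).eq_formalMultilinearSeries (key b hb)
  ext k
  rw [← hP a, ← hP b, this]

end PowerSeries

section Bounds
variable {V : Type*} [NormedAddCommGroup V]

theorem abs_laguerreFun_le_pow {n : ℕ} (hn : 1 ≤ n) (k : ℕ) {κ : ℝ} (hκ : 0 ≤ κ) (y : V) :
    |laguerreFun n k κ y| ≤ 4 ^ k * (4 / 3) ^ n := by
  refine (abs_laguerreFun_le_majorant n k hκ y).trans ?_
  have h := hasSum_laguerreMajorant hn κ y (r := 1 / 4) (by norm_num [abs_lt])
  have h1 := le_hasSum h k fun j _ => mul_nonneg (by positivity)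
    ((abs_nonneg _).trans (abs_laguerreFun_le_majorant n j hκ y))
  have h2 : Real.exp (-(κ / 4 * ((1 - 3 * (1 / 4)) / (1 - 1 / 4))) * ‖y‖ ^ 2) ≤ 1 := by
    rw [Real.exp_le_one_iff]
    nlinarith [mul_nonneg hκ (sq_nonneg ‖y‖)]
  have h3 : (1 / 4 : ℝ) ^ k * laguerreMajorant n k κ y ≤ (4 / 3) ^ n := by
    refine h1.trans ?_
    calc _ ≤ (1 - 1 / 4 : ℝ)⁻¹ ^ n * 1 := by gcongr
      _ = _ := by norm_num
  calc laguerreMajorant n k κ y = 4 ^ k * ((1 / 4 : ℝ) ^ k * laguerreMajorant n k κ y) := by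
        rw [← mul_assoc, ← mul_pow]; norm_num
    _ ≤ _ := by gcongr

theorem abs_mehlerFun_le (n : ℕ) {κ r : ℝ} (hκ : 0 ≤ κ) (hr : |r| < 1) (y : V) :
    |mehlerFun n κ r y| ≤ (1 - r)⁻¹ ^ n := by
  have r1 := one_sub_pos_of_abs_lt hr
  have r2 := one_add_pos_of_abs_lt hr
  rw [mehlerFun, abs_mul, Real.abs_exp, abs_of_nonneg (by positivity)]
  refine mul_le_of_le_one_right (by positivity) ?_
  rw [Real.exp_le_one_iff, neg_mul, neg_nonpos]
  positivity

theorem norm_twist [InnerProductSpace ℝ V] (lam : ℝ) (w y : V) :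
    ‖Complex.exp (-(Complex.I / 2 * lam * (inner ℝ w y : ℝ)))‖ = 1 := by
  rw [show -(Complex.I / 2 * lam * (inner ℝ w y : ℝ)) =
    ((-(lam / 2 * inner ℝ w y) : ℝ) : ℂ) * Complex.I by push_cast; ring]
  exact Complex.norm_exp_ofReal_mul_I _

end Bounds

section Projection
variable {V : Type*} [NormedAddCommGroup V] [InnerProductSpace ℝ V] [FiniteDimensional ℝ V]
  [MeasurableSpace V] [BorelSpace V]

theorem hasSum_integral_laguerreFun_mul {n : ℕ} (hn : 1 ≤ n) {κ : ℝ} (hκ : 0 < κ) {r : ℝ}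
    (hr : |r| < 1 / 4) {g : V → ℂ} (hg : AEStronglyMeasurable g) {C : ℝ} (hC : ∀ y, ‖g y‖ ≤ C) :
    HasSum (fun k : ℕ => r ^ k • ∫ y : V, (laguerreFun n k κ y : ℂ) * g y)
      (∫ y : V, (mehlerFun n κ r y : ℂ) * g y) := by
  have hr1 : |(|r|)| < 1 := by rw [abs_abs]; linarith
  have hr2 := one_sub_pos_of_abs_lt hr1
  have hs (y : V) := (hasSum_laguerreMajorant hn κ y hr1).mul_right C
  simp_rw [← integral_smul]
  refine hasSum_integral_of_dominated_convergence
    (fun k y => |r| ^ k * laguerreMajorant n k κ y * C) ?_ ?_ ?_ ?_ ?_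
  · intro k
    exact (((Complex.continuous_ofReal.comp
      (continuous_laguerreFun n k κ)).aestronglyMeasurable).mul hg).const_smul _
  · refine fun k => Eventually.of_forall fun y => ?_
    rw [norm_smul, norm_mul, Complex.norm_real, norm_pow, Real.norm_eq_abs, Real.norm_eq_abs,
      ← mul_assoc]
    have := abs_laguerreFun_le_majorant n k hκ.le y
    have h0 := (abs_nonneg _).trans this
    have := hC y
    gcongr
  · exact Eventually.of_forall fun y => (hs y).summable
  · simp_rw [fun y => (hs y).tsum_eq]
    refine ((integrable_exp_neg_mul_sq_norm ?_).const_mul _).mul_const _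
    have : 0 < 1 - 3 * |r| := by linarith
    positivity
  · refine Eventually.of_forall fun y => ?_
    have := (Complex.hasSum_ofReal.mpr (hasSum_laguerreFun hn κ y (r := r) (by linarith))).mul_right
      (g y)
    convert! this using 1
    ext k
    rw [Complex.real_smul]
    push_cast
    ring

theorem integral_mehlerFun_mul_laguerreFun_twisted {n : ℕ} (hn : 1 ≤ n)
    (hdim : Module.finrank ℝ V = 2 * n) {lam : ℝ} (hlam : lam ≠ 0) {r : ℝ} (hr : |r| < 1) (k : ℕ)
    {x w : V} (hxw : inner ℝ x w = 0) (hw : ‖w‖ = ‖x‖) :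
    ∫ y : V, ((mehlerFun n |lam| r y * laguerreFun n k |lam| (x - y) : ℝ) : ℂ) *
      Complex.exp (-(Complex.I / 2 * lam * (inner ℝ w y : ℝ))) =
    (((2 * π / |lam|) ^ n * laguerreFun n k |lam| x : ℝ) : ℂ) * r ^ k := by
  have hκ : 0 < |lam| := abs_pos.mpr hlam
  let g : V → ℂ := fun y => (mehlerFun n |lam| r (x - y) : ℂ) *
    Complex.exp (-(Complex.I / 2 * lam * (inner ℝ w (x - y) : ℝ)))
  have hg : Continuous g := by
    have := continuous_mehlerFun (V := V) n |lam| r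
    fun_prop
  have hgC (y : V) : ‖g y‖ ≤ (1 - r)⁻¹ ^ n := by
    rw [norm_mul, norm_twist, mul_one, Complex.norm_real]
    exact abs_mehlerFun_le n hκ.le hr _
  have h1 : (fun j : ℕ => ∫ y : V, (laguerreFun n j |lam| y : ℂ) * g y) =
      fun j : ℕ => (((2 * π / |lam|) ^ n * laguerreFun n j |lam| x : ℝ) : ℂ) * r ^ j := by
    refine eq_of_hasSum_pow_smul (ε := 1 / 4) (by norm_num)
      (g := fun s => ∫ y : V, (mehlerFun n |lam| s y : ℂ) * g y)
      (fun s hs => hasSum_integral_laguerreFun_mul hn hκ hs hg.aestronglyMeasurable hgC) ?_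
    intro s hs
    have hs1 : |s| < 1 := by linarith
    have hrs : |r * s| < 1 := by
      rw [abs_mul]; exact mul_lt_one_of_nonneg_of_lt_one_left (abs_nonneg _) hr hs1.le
    have e : ∫ y : V, (mehlerFun n |lam| s y : ℂ) * g y =
        (((2 * π / |lam|) ^ n * mehlerFun n |lam| (r * s) x : ℝ) : ℂ) := by
      rw [← integral_mehlerFun_twisted hdim hlam hr hs1 hxw hw,
        ← integral_sub_left_eq_self _ _ x]
      refine integral_congr_ae (Eventually.of_forall fun y => ?_)
      simp only [g]
      rw [sub_sub_cancel]
      push_cast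
      ring
    rw [e]
    convert! Complex.hasSum_ofReal.mpr
      ((hasSum_laguerreFun hn |lam| x hrs).mul_left ((2 * π / |lam|) ^ n)) using 1
    ext j
    rw [Complex.real_smul]
    push_cast
    ring
  rw [← congrFun h1 k, ← integral_sub_left_eq_self _ _ x]
  refine integral_congr_ae (Eventually.of_forall fun y => ?_)
  simp only [g]
  rw [sub_sub_cancel]
  push_cast
  ring

/-- The Laguerre functions are idempotents for twisted convolution, up to normalisation. -/
theorem integral_laguerreFun_mul_laguerreFun_twisted {n : ℕ} (hn : 1 ≤ n)
    (hdim : Module.finrank ℝ V = 2 * n) {lam : ℝ} (hlam : lam ≠ 0) (k : ℕ)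
    {x w : V} (hxw : inner ℝ x w = 0) (hw : ‖w‖ = ‖x‖) :
    ∫ y : V, ((laguerreFun n k |lam| y * laguerreFun n k |lam| (x - y) : ℝ) : ℂ) *
      Complex.exp (-(Complex.I / 2 * lam * (inner ℝ w y : ℝ))) =
    (((2 * π / |lam|) ^ n * laguerreFun n k |lam| x : ℝ) : ℂ) := by
  have hκ : 0 < |lam| := abs_pos.mpr hlam
  let g : V → ℂ := fun y => (laguerreFun n k |lam| (x - y) : ℂ) *
    Complex.exp (-(Complex.I / 2 * lam * (inner ℝ w y : ℝ)))
  have hg : Continuous g := by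
    have := continuous_laguerreFun (V := V) n k |lam|
    fun_prop
  have hgC (y : V) : ‖g y‖ ≤ 4 ^ k * (4 / 3) ^ n := by
    rw [norm_mul, norm_twist, mul_one, Complex.norm_real]
    exact abs_laguerreFun_le_pow hn k hκ.le _
  have h1 : (fun j : ℕ => ∫ y : V, (laguerreFun n j |lam| y : ℂ) * g y) =
      Pi.single k (((2 * π / |lam|) ^ n * laguerreFun n k |lam| x : ℝ) : ℂ) := by
    refine eq_of_hasSum_pow_smul (ε := 1 / 4) (by norm_num)
      (g := fun s => ∫ y : V, (mehlerFun n |lam| s y : ℂ) * g y)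
      (fun s hs => hasSum_integral_laguerreFun_mul hn hκ hs hg.aestronglyMeasurable hgC) ?_
    intro s hs
    have e : ∫ y : V, (mehlerFun n |lam| s y : ℂ) * g y =
        s ^ k • (((2 * π / |lam|) ^ n * laguerreFun n k |lam| x : ℝ) : ℂ) := by
      rw [Complex.real_smul, Complex.ofReal_pow, mul_comm,
        ← integral_mehlerFun_mul_laguerreFun_twisted hn hdim hlam (r := s) (by linarith) k hxw hw]
      refine integral_congr_ae (Eventually.of_forall fun y => ?_)
      simp only [g]
      push_cast
      ring
    rw [e]
    convert! hasSum_single (f := fun j => s ^ j •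
      (Pi.single k (((2 * π / |lam|) ^ n * laguerreFun n k |lam| x : ℝ) : ℂ) : ℕ → ℂ) j) k ?_
      using 1
    · simp
    · intro j hj
      simp [hj]
  have h2 := congrFun h1 k
  rw [Pi.single_eq_same] at h2
  rw [← h2]
  refine integral_congr_ae (Eventually.of_forall fun y => ?_)
  simp only [g]
  push_cast
  ring

end Projection

section Supremum
variable {V : Type*} [NormedAddCommGroup V] [InnerProductSpace ℝ V] [FiniteDimensional ℝ V]
  [MeasurableSpace V] [BorelSpace V]

theorem integrable_laguerreFun {n : ℕ} (hn : 1 ≤ n) (k : ℕ) {κ : ℝ} (hκ : 0 < κ) :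
    Integrable (laguerreFun n k κ : V → ℝ) := by
  have h0 : |(1 / 4 : ℝ)| < 1 := by norm_num [abs_lt]
  refine Integrable.mono' (g := fun y => 4 ^ k * ((1 - 1 / 4 : ℝ)⁻¹ ^ n *
    Real.exp (-(κ / 4 * ((1 - 3 * (1 / 4)) / (1 - 1 / 4))) * ‖y‖ ^ 2))) ?_
    (continuous_laguerreFun n k κ).aestronglyMeasurable (Eventually.of_forall fun y => ?_)
  · exact ((integrable_exp_neg_mul_sq_norm (by norm_num; positivity)).const_mul _).const_mul _
  · have h := le_hasSum (hasSum_laguerreMajorant hn κ y h0) k fun j _ => mul_nonneg (by positivity)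
      ((abs_nonneg _).trans (abs_laguerreFun_le_majorant n j hκ.le y))
    calc ‖laguerreFun n k κ y‖ ≤ laguerreMajorant n k κ y :=
          abs_laguerreFun_le_majorant n k hκ.le y
      _ = 4 ^ k * ((1 / 4 : ℝ) ^ k * laguerreMajorant n k κ y) := by
          rw [← mul_assoc, ← mul_pow]; norm_num
      _ ≤ _ := by gcongr

theorem integrable_laguerreFun_sq {n : ℕ} (hn : 1 ≤ n) (k : ℕ) {κ : ℝ} (hκ : 0 < κ) :
    Integrable (fun y : V => laguerreFun n k κ y ^ 2) := by
  simp_rw [pow_two]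
  exact (integrable_laguerreFun hn k hκ).bdd_mul
    (continuous_laguerreFun n k κ).aestronglyMeasurable
    (Eventually.of_forall fun y => abs_laguerreFun_le_pow hn k hκ.le y)

theorem integral_laguerreFun_sq {n : ℕ} (hn : 1 ≤ n) (hdim : Module.finrank ℝ V = 2 * n) (k : ℕ)
    {κ : ℝ} (hκ : 0 < κ) :
    ∫ y : V, laguerreFun n k κ y ^ 2 = (2 * π / κ) ^ n * laguerreFun n k κ (0 : V) := by
  have h := integral_laguerreFun_mul_laguerreFun_twisted hn hdim hκ.ne' k (x := (0 : V)) (w := 0)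
    (by simp) rfl
  simp only [zero_sub, inner_zero_left, laguerreFun_neg, Complex.ofReal_zero, mul_zero, neg_zero,
    Complex.exp_zero, mul_one, integral_complex_ofReal, abs_of_pos hκ, ← pow_two] at h
  exact_mod_cast h

/-- Laguerre functions attain their maximum at the origin. -/
theorem abs_laguerreFun_le_zero {n : ℕ} (hn : 1 ≤ n) (hdim : Module.finrank ℝ V = 2 * n) (k : ℕ)
    {κ : ℝ} (hκ : 0 < κ) {x w : V} (hxw : inner ℝ x w = 0) (hw : ‖w‖ = ‖x‖) :
    |laguerreFun n k κ x| ≤ laguerreFun n k κ (0 : V) := by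
  have h := integral_laguerreFun_mul_laguerreFun_twisted hn hdim hκ.ne' k hxw hw
  rw [abs_of_pos hκ] at h
  have hi := integrable_laguerreFun_sq (V := V) hn k hκ
  have hi' : Integrable (fun y : V => laguerreFun n k κ (x - y) ^ 2) := hi.comp_sub_left x
  have hc : 0 < (2 * π / κ) ^ n := by positivity
  refine le_of_mul_le_mul_left ?_ hc
  calc (2 * π / κ) ^ n * |laguerreFun n k κ x|
      = ‖(((2 * π / κ) ^ n * laguerreFun n k κ x : ℝ) : ℂ)‖ := by
        rw [Complex.norm_real, Real.norm_eq_abs, abs_mul, abs_of_pos hc]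
    _ ≤ ∫ y : V, (laguerreFun n k κ y ^ 2 + laguerreFun n k κ (x - y) ^ 2) / 2 := by
        rw [← h]
        refine norm_integral_le_of_norm_le ((hi.add hi').div_const 2)
          (Eventually.of_forall fun y => ?_)
        rw [norm_mul, norm_twist, mul_one, Complex.norm_real, Real.norm_eq_abs, abs_le]
        constructor <;>
          nlinarith [sq_nonneg (laguerreFun n k κ y + laguerreFun n k κ (x - y)),
            sq_nonneg (laguerreFun n k κ y - laguerreFun n k κ (x - y))]
    _ = (2 * π / κ) ^ n * laguerreFun n k κ (0 : V) := by
        rw [integral_div, integral_add hi hi',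
          integral_sub_left_eq_self (fun y : V => laguerreFun n k κ y ^ 2) volume x,
          integral_laguerreFun_sq hn hdim k hκ]
        ring

theorem abs_laguerreFun_le_degree_pow {n : ℕ} (hn : 1 ≤ n) (hdim : Module.finrank ℝ V = 2 * n)
    (k : ℕ) {κ : ℝ} (hκ : 0 < κ) {x w : V} (hxw : inner ℝ x w = 0) (hw : ‖w‖ = ‖x‖) :
    |laguerreFun n k κ x| ≤ (2 * k + n) ^ n := by
  refine (abs_laguerreFun_le_zero hn hdim k hκ hxw hw).trans ?_
  rw [laguerreFun_zero]
  have h1 : (k + n - 1).choose k = (k + n - 1).choose (n - 1) := by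
    rw [← Nat.choose_symm (by omega)]
    congr 1
    omega
  have h2 : (k + n - 1).choose k ≤ (2 * k + n) ^ n := by
    rw [h1]
    calc _ ≤ (k + n - 1) ^ (n - 1) := Nat.choose_le_pow _ _
      _ ≤ (2 * k + n) ^ (n - 1) := Nat.pow_le_pow_left (by omega) _
      _ ≤ _ := Nat.pow_le_pow_right (by omega) (by omega)
  exact_mod_cast h2

/-- The rescaled Mehler kernels are an approximate identity as `r → 1`. -/
theorem tendsto_integral_mehlerFun_mul {n : ℕ} (hdim : Module.finrank ℝ V = 2 * n)
    {κ : ℝ} (hκ : 0 < κ) {G : V → ℂ} (hG : Integrable G) (hG0 : ContinuousAt G 0) :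
    Tendsto (fun r : ℝ => ∫ y : V, (mehlerFun n κ r y : ℂ) * G y) (nhdsWithin 1 (Set.Iio 1))
      (nhds ((((2 * π / κ) ^ n : ℝ) : ℂ) * G 0)) := by
  let c : ℝ → ℝ := fun r => κ / 4 * ((1 + r) / (1 - r)) / π ^ 2
  have hpos : ∀ᶠ r in nhdsWithin (1 : ℝ) (Set.Iio 1), 0 < r ∧ r < 1 :=
    Filter.Eventually.and (nhdsWithin_le_nhds (lt_mem_nhds one_pos)) self_mem_nhdsWithin
  have hc : Tendsto c (nhdsWithin 1 (Set.Iio 1)) atTop := by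
    have h1 : Tendsto (fun r : ℝ => (1 - r)⁻¹) (nhdsWithin 1 (Set.Iio 1)) atTop := by
      refine tendsto_inv_nhdsGT_zero.comp (tendsto_nhdsWithin_iff.mpr ⟨?_, ?_⟩)
      · have : Tendsto (fun r : ℝ => 1 - r) (nhds 1) (nhds (1 - 1)) :=
          (continuous_const.sub continuous_id).tendsto _
        rw [sub_self] at this
        exact this.mono_left nhdsWithin_le_nhds
      · filter_upwards [hpos] with r hr
        exact sub_pos.mpr hr.2
    have h2 : Tendsto (fun r : ℝ => κ / 4 / π ^ 2 * (1 + r)) (nhdsWithin 1 (Set.Iio 1))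
        (nhds (κ / 4 / π ^ 2 * (1 + 1))) :=
      Tendsto.mono_left (Continuous.tendsto (by fun_prop) 1) nhdsWithin_le_nhds
    refine (h2.pos_mul_atTop (by positivity) h1).congr fun r => ?_
    simp only [c]
    ring
  have h := (Real.tendsto_integral_gaussian_smul' hG hG0).comp hc
  have h3 : Tendsto (fun r : ℝ => (((4 * π / (κ * (1 + r))) ^ n : ℝ) : ℂ))
      (nhdsWithin 1 (Set.Iio 1)) (nhds (((4 * π / (κ * (1 + 1))) ^ n : ℝ) : ℂ)) := by
    refine Tendsto.mono_left ?_ nhdsWithin_le_nhds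
    refine (Complex.continuous_ofReal.tendsto _).comp (ContinuousAt.tendsto (x := (1 : ℝ)) ?_)
    fun_prop (disch := positivity)
  have h4 := h3.mul h
  rw [show 4 * π / (κ * (1 + 1)) = 2 * π / κ by field_simp; norm_num] at h4
  refine h4.congr' ?_
  filter_upwards [hpos] with r hr
  rw [Function.comp_apply, ← integral_const_mul]
  refine integral_congr_ae (Eventually.of_forall fun y => ?_)
  have h5 : ((Module.finrank ℝ V : ℕ) : ℂ) / 2 = (n : ℂ) := by rw [hdim]; push_cast; ring
  have r1 : 0 < 1 - r := by linarith [hr.2]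
  have r2 : 0 < 1 + r := by linarith [hr.1]
  have h6 : (-(π : ℂ) ^ 2 * (c r : ℂ) * ((‖(0 : V) - y‖ : ℝ) : ℂ) ^ 2) =
      ((-(κ / 4 * ((1 + r) / (1 - r))) * ‖y‖ ^ 2 : ℝ) : ℂ) := by
    rw [zero_sub, norm_neg]
    norm_cast
    simp only [c]
    field_simp
  simp only
  rw [h5, Complex.cpow_natCast, h6, ← Complex.ofReal_exp, smul_eq_mul, ← mul_assoc, ← mul_assoc,
    mehlerFun]
  congr 1
  norm_cast
  rw [← mul_pow]
  congr 2
  simp only [c]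
  field_simp

end Supremum

section HermiteOperator
open scoped LineDeriv SchwartzMap
variable {V : Type*} [NormedAddCommGroup V] [InnerProductSpace ℝ V]

theorem hasLineDerivAt_mehlerFun (n : ℕ) (κ r : ℝ) (y e : V) :
    HasLineDerivAt ℝ (mehlerFun n κ r)
      (mehlerFun n κ r y * (-(2 * (κ / 4 * ((1 + r) / (1 - r)))) * inner ℝ y e)) y e := by
  have h1 : HasDerivAt (fun t : ℝ => y + t • e) e 0 := by
    simpa using ((hasDerivAt_id (0 : ℝ)).smul_const e).const_add y
  have h2 := (((h1.norm_sq).const_mul (-(κ / 4 * ((1 + r) / (1 - r))))).exp).const_mul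
    ((1 - r)⁻¹ ^ n)
  rw [zero_smul, add_zero] at h2
  unfold HasLineDerivAt mehlerFun
  convert! h2 using 1
  ring

theorem hasLineDerivAt_mehlerFun_mul_inner (n : ℕ) (κ r : ℝ) (y e : V) :
    HasLineDerivAt ℝ
      (fun y => mehlerFun n κ r y * (-(2 * (κ / 4 * ((1 + r) / (1 - r)))) * inner ℝ y e))
      (mehlerFun n κ r y * ((2 * (κ / 4 * ((1 + r) / (1 - r)))) ^ 2 * inner ℝ y e ^ 2 -
        2 * (κ / 4 * ((1 + r) / (1 - r))) * ‖e‖ ^ 2)) y e := by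
  have h1 : HasDerivAt (fun t : ℝ => y + t • e) e 0 := by
    simpa using ((hasDerivAt_id (0 : ℝ)).smul_const e).const_add y
  have h2 := h1.inner ℝ (hasDerivAt_const (0 : ℝ) e)
  have h3 : HasDerivAt (fun t : ℝ => mehlerFun n κ r (y + t • e)) _ 0 :=
    hasLineDerivAt_mehlerFun n κ r y e
  have h4 := h3.mul (h2.const_mul (-(2 * (κ / 4 * ((1 + r) / (1 - r))))))
  rw [zero_smul, add_zero] at h4
  unfold HasLineDerivAt
  convert! h4 using 1
  rw [inner_zero_right, real_inner_self_eq_norm_sq]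
  ring

variable [FiniteDimensional ℝ V]

/-- The Hermite operator `-Δ + κ²|y|²/4` in the first variable. -/
def hermiteOp (κ : ℝ) (h : 𝓢(V × ℝ, ℂ)) : 𝓢(V × ℝ, ℂ) :=
  (κ ^ 2 / 4) • SchwartzMap.smulLeftCLM ℂ (fun p : V × ℝ => ‖p.1‖ ^ 2) h -
    ∑ i, ∂_{((stdOrthonormalBasis ℝ V i, 0) : V × ℝ)}
      (∂_{((stdOrthonormalBasis ℝ V i, 0) : V × ℝ)} h)

variable [MeasurableSpace V] [BorelSpace V]

instance isAddHaarMeasure_volume_prod_real : (volume : Measure (V × ℝ)).IsAddHaarMeasure :=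
  Measure.prod.instIsAddHaarMeasure _ _

theorem integrable_mehlerFun_mul_smul (n : ℕ) {κ r : ℝ} (hκ : 0 ≤ κ) (hr : |r| < 1)
    {g : V × ℝ → ℝ} (hg : g.HasTemperateGrowth) (h : 𝓢(V × ℝ, ℂ)) :
    Integrable (fun p : V × ℝ => (mehlerFun n κ r p.1 * g p) • h p) := by
  have h1 : Integrable (SchwartzMap.smulLeftCLM ℂ g h) (volume : Measure (V × ℝ)) :=
    SchwartzMap.integrable _
  rw [SchwartzMap.smulLeftCLM_apply hg] at h1
  simp_rw [mul_smul]
  refine Integrable.bdd_smul (φ := fun p : V × ℝ => mehlerFun n κ r p.1) h1 ((1 - r)⁻¹ ^ n) ?_ ?_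
  · exact ((continuous_mehlerFun n κ r).comp continuous_fst).aestronglyMeasurable
  · exact Eventually.of_forall fun p => abs_mehlerFun_le n hκ hr p.1

theorem integral_smul_lineDeriv_fst {u u' : V → ℝ} {e : V}
    (hu : ∀ y, HasLineDerivAt ℝ u (u' y) y e) (h : 𝓢(V × ℝ, ℂ))
    (h1 : Integrable (fun p : V × ℝ => u' p.1 • h p))
    (h2 : Integrable (fun p : V × ℝ => u p.1 • ∂_{((e, 0) : V × ℝ)} h p))
    (h3 : Integrable (fun p : V × ℝ => u p.1 • h p)) :
    ∫ p : V × ℝ, u p.1 • ∂_{((e, 0) : V × ℝ)} h p = -∫ p : V × ℝ, u' p.1 • h p := by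
  have hd (p : V × ℝ) : HasLineDerivAt ℝ h (∂_{((e, 0) : V × ℝ)} h p) p ((e, 0) : V × ℝ) := by
    rw [SchwartzMap.lineDerivOp_apply_eq_fderiv]
    exact h.differentiableAt.hasFDerivAt.hasLineDerivAt _
  have hu' (p : V × ℝ) :
      HasLineDerivAt ℝ (fun p : V × ℝ => u p.1) (u' p.1) p ((e, 0) : V × ℝ) := hu p.1
  exact integral_bilinear_hasLineDerivAt_right_eq_neg_left_of_integrable
    (B := (ContinuousLinearMap.lsmul ℝ ℝ : ℝ →L[ℝ] ℂ →L[ℝ] ℂ)) h1 h2 h3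
    (fun p _ => hu' p) (fun p _ => hd p)

theorem integral_mehlerFun_smul_lineDeriv_lineDeriv (n : ℕ) {κ r : ℝ} (hκ : 0 ≤ κ) (hr : |r| < 1)
    (h : 𝓢(V × ℝ, ℂ)) (e : V) :
    ∫ p : V × ℝ, mehlerFun n κ r p.1 • ∂_{((e, 0) : V × ℝ)} (∂_{((e, 0) : V × ℝ)} h) p =
      ∫ p : V × ℝ, (mehlerFun n κ r p.1 * ((2 * (κ / 4 * ((1 + r) / (1 - r)))) ^ 2 *
        inner ℝ p.1 e ^ 2 - 2 * (κ / 4 * ((1 + r) / (1 - r))) * ‖e‖ ^ 2)) • h p := by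
  have t0 : (fun _ : V × ℝ => (1 : ℝ)).HasTemperateGrowth := by fun_prop
  have tf : (fun p : V × ℝ => p.1).HasTemperateGrowth :=
    (ContinuousLinearMap.fst ℝ V ℝ).hasTemperateGrowth
  have ti : (fun p : V × ℝ => (inner ℝ p.1 e : ℝ)).HasTemperateGrowth :=
    (Function.hasTemperateGrowth_inner_left e).comp tf
  have t1 : (fun p : V × ℝ => -(2 * (κ / 4 * ((1 + r) / (1 - r)))) *
      (inner ℝ p.1 e : ℝ)).HasTemperateGrowth := by fun_prop
  have t2 : (fun p : V × ℝ => (2 * (κ / 4 * ((1 + r) / (1 - r)))) ^ 2 *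
        inner ℝ p.1 e ^ 2 - 2 * (κ / 4 * ((1 + r) / (1 - r))) * ‖e‖ ^ 2).HasTemperateGrowth := by
    fun_prop
  have i0 (h : 𝓢(V × ℝ, ℂ)) : Integrable (fun p : V × ℝ => mehlerFun n κ r p.1 • h p) := by
    simpa using integrable_mehlerFun_mul_smul n hκ hr t0 h
  have i1 (h : 𝓢(V × ℝ, ℂ)) := integrable_mehlerFun_mul_smul n hκ hr t1 h
  have i2 := integrable_mehlerFun_mul_smul n hκ hr t2 h
  rw [integral_smul_lineDeriv_fst (fun y => hasLineDerivAt_mehlerFun n κ r y e) _ (i1 _) (i0 _)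
    (i0 _), integral_smul_lineDeriv_fst (fun y => hasLineDerivAt_mehlerFun_mul_inner n κ r y e) _
    i2 (i1 _) (i1 _), neg_neg]

theorem integral_mehlerFun_smul_hermiteOp {n : ℕ} (hdim : Module.finrank ℝ V = 2 * n) {κ r : ℝ}
    (hκ : 0 ≤ κ) (hr : |r| < 1) (h : 𝓢(V × ℝ, ℂ)) :
    ∫ p : V × ℝ, mehlerFun n κ r p.1 • hermiteOp κ h p =
      ∫ p : V × ℝ, (κ * ((n * ((1 + r) / (1 - r)) - κ * ‖p.1‖ ^ 2 * (r / (1 - r) ^ 2)) *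
        mehlerFun n κ r p.1)) • h p := by
  have r1 := (one_sub_pos_of_abs_lt hr).ne'
  have t0 : (fun _ : V × ℝ => (1 : ℝ)).HasTemperateGrowth := by fun_prop
  have tf : (fun p : V × ℝ => p.1).HasTemperateGrowth :=
    (ContinuousLinearMap.fst ℝ V ℝ).hasTemperateGrowth
  have ti (e : V) : (fun p : V × ℝ => (inner ℝ p.1 e : ℝ)).HasTemperateGrowth :=
    (Function.hasTemperateGrowth_inner_left e).comp tf
  have tn : (fun p : V × ℝ => ‖p.1‖ ^ 2).HasTemperateGrowth :=
    (Function.hasTemperateGrowth_norm_sq V).comp tf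
  have t2 (e : V) : (fun p : V × ℝ => (2 * (κ / 4 * ((1 + r) / (1 - r)))) ^ 2 *
        inner ℝ p.1 e ^ 2 - 2 * (κ / 4 * ((1 + r) / (1 - r))) * ‖e‖ ^ 2).HasTemperateGrowth := by
    have := ti e
    fun_prop
  have i0 (h : 𝓢(V × ℝ, ℂ)) : Integrable (fun p : V × ℝ => mehlerFun n κ r p.1 • h p) := by
    simpa using integrable_mehlerFun_mul_smul n hκ hr t0 h
  have e1 : ∀ p : V × ℝ, mehlerFun n κ r p.1 • hermiteOp κ h p =
      (κ ^ 2 / 4) • ((mehlerFun n κ r p.1 * ‖p.1‖ ^ 2) • h p) -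
      ∑ i, mehlerFun n κ r p.1 • ∂_{((stdOrthonormalBasis ℝ V i, 0) : V × ℝ)}
        (∂_{((stdOrthonormalBasis ℝ V i, 0) : V × ℝ)} h) p := by
    intro p
    rw [hermiteOp, sub_apply, smul_apply,
      SchwartzMap.smulLeftCLM_apply_apply tn, sum_apply, smul_sub, Finset.smul_sum,
      smul_comm, mul_smul]
  have in1 : Integrable (fun p : V × ℝ =>
      (κ ^ 2 / 4) • ((mehlerFun n κ r p.1 * ‖p.1‖ ^ 2) • h p)) :=
    (integrable_mehlerFun_mul_smul n hκ hr tn h).smul (κ ^ 2 / 4)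
  simp_rw [e1]
  rw [integral_sub in1
      (integrable_finsetSum _ fun i _ => i0 _),
    integral_finsetSum _ fun i _ => i0 _]
  simp_rw [integral_mehlerFun_smul_lineDeriv_lineDeriv n hκ hr h]
  rw [← integral_finsetSum _ fun i _ => integrable_mehlerFun_mul_smul n hκ hr (t2 _) h,
    ← integral_sub in1
      (integrable_finsetSum _ fun i _ => integrable_mehlerFun_mul_smul n hκ hr (t2 _) h)]
  refine integral_congr_ae (Eventually.of_forall fun p => ?_)
  simp only
  rw [← Finset.sum_smul, smul_smul, ← sub_smul]
  congr 1
  rw [← Finset.mul_sum, Finset.sum_sub_distrib, ← Finset.mul_sum,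
    OrthonormalBasis.sum_sq_inner_left]
  simp only [OrthonormalBasis.norm_eq_one, one_pow, mul_one, Finset.sum_const, Finset.card_univ,
    Fintype.card_fin, hdim]
  rw [nsmul_eq_mul]
  push_cast
  field_simp
  ring

end HermiteOperator

section Expansion
open scoped LineDeriv SchwartzMap

theorem summable_abs_pow_mul_degree_pow (n m : ℕ) {r : ℝ} (hr : |r| < 1) :
    Summable (fun k : ℕ => |r| ^ k * (2 * (k : ℝ) + n) ^ m) := by
  simp_rw [add_pow, Finset.mul_sum]
  refine summable_sum fun i _ => ?_
  have h := (summable_pow_mul_geometric_of_norm_lt_one i (r := |r|) (by simpa using hr)).mul_left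
    (2 ^ i * (n : ℝ) ^ (m - i) * (m.choose i))
  refine h.congr fun k => ?_
  rw [mul_pow]
  ring

theorem hasSum_integral_smul {X : Type*} [MeasurableSpace X] {μ : Measure X} {u : ℕ → X → ℝ}
    {S : X → ℝ} {B : ℕ → ℝ} {r : ℝ} {h : X → ℂ} (hh : Integrable h μ)
    (hu : ∀ k, AEStronglyMeasurable (u k) μ) (hB : ∀ k x, |u k x| ≤ B k)
    (hsum : Summable fun k => |r| ^ k * B k) (hS : ∀ x, HasSum (fun k => r ^ k * u k x) (S x)) :
    HasSum (fun k => r ^ k • ∫ x, u k x • h x ∂μ) (∫ x, S x • h x ∂μ) := by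
  simp_rw [← integral_smul]
  refine hasSum_integral_of_dominated_convergence
    (fun k x => |r| ^ k * B k * ‖h x‖) ?_ ?_ ?_ ?_ ?_
  · exact fun k => ((hu k).smul hh.aestronglyMeasurable).const_smul _
  · refine fun k => Eventually.of_forall fun x => ?_
    rw [norm_smul, norm_smul, norm_pow, Real.norm_eq_abs, Real.norm_eq_abs, ← mul_assoc]
    have := hB k x
    gcongr
  · exact Eventually.of_forall fun x => hsum.mul_right _
  · simp_rw [tsum_mul_right]
    exact hh.norm.const_mul _
  · refine Eventually.of_forall fun x => ?_
    simpa only [smul_smul] using (hS x).smul_const (h x)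

variable {V : Type*} [NormedAddCommGroup V] [InnerProductSpace ℝ V]

theorem continuous_integral_snd (h : 𝓢(V × ℝ, ℂ)) : Continuous fun y => ∫ t : ℝ, h (y, t) := by
  obtain ⟨C, hC⟩ : ∃ C, ∀ p, (1 + ‖p‖) ^ 2 * ‖h p‖ ≤ C :=
    ⟨_, fun p => by
      simpa using SchwartzMap.one_add_le_sup_seminorm_apply (𝕜 := ℝ) (m := (2, 0)) le_rfl
        le_rfl h p⟩
  refine continuous_of_dominated (bound := fun t : ℝ => C * (1 + ‖t‖) ^ (-(2 : ℝ))) ?_ ?_ ?_ ?_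
  · intro y
    exact (h.continuous.comp (by fun_prop)).aestronglyMeasurable
  · refine fun y => Eventually.of_forall fun t => ?_
    rw [Real.rpow_neg (by positivity), ← div_eq_mul_inv, le_div_iff₀ (by positivity)]
    have h1 := hC (y, t)
    have h2 : ‖t‖ ≤ ‖(y, t)‖ := norm_snd_le (y, t)
    rw [mul_comm]
    refine le_trans ?_ h1
    norm_cast
    gcongr
  · exact (integrable_one_add_norm (by simp)).const_mul _
  · exact Eventually.of_forall fun t => h.continuous.comp (by fun_prop)

variable [FiniteDimensional ℝ V] [MeasurableSpace V] [BorelSpace V]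

/-- The Laguerre coefficients of a Schwartz function, as a function of its first variable. -/
def laguerreCoeff (n : ℕ) (κ : ℝ) (h : 𝓢(V × ℝ, ℂ)) (k : ℕ) : ℂ :=
  ∫ p : V × ℝ, laguerreFun n k κ p.1 • h p


theorem abs_laguerreFun_le_degree_pow_of_forall {n : ℕ} (hn : 1 ≤ n)
    (hdim : Module.finrank ℝ V = 2 * n)
    (hperp : ∀ x : V, ∃ w : V, inner ℝ x w = 0 ∧ ‖w‖ = ‖x‖) {κ : ℝ} (hκ : 0 < κ) (k : ℕ) (x : V) :
    |laguerreFun n k κ x| ≤ (2 * k + n) ^ n := by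
  obtain ⟨w, h1, h2⟩ := hperp x
  exact abs_laguerreFun_le_degree_pow hn hdim k hκ h1 h2

theorem laguerreCoeff_hermiteOp {n : ℕ} (hn : 1 ≤ n) (hdim : Module.finrank ℝ V = 2 * n)
    (hperp : ∀ x : V, ∃ w : V, inner ℝ x w = 0 ∧ ‖w‖ = ‖x‖) {κ : ℝ} (hκ : 0 < κ)
    (h : 𝓢(V × ℝ, ℂ)) (k : ℕ) :
    laguerreCoeff n κ (hermiteOp κ h) k = (κ * (2 * k + n)) • laguerreCoeff n κ h k := by
  have hb := abs_laguerreFun_le_degree_pow_of_forall hn hdim hperp hκ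
  have hc (k : ℕ) : AEStronglyMeasurable (fun p : V × ℝ => laguerreFun n k κ p.1) :=
    ((continuous_laguerreFun n k κ).comp continuous_fst).aestronglyMeasurable
  refine congrFun (eq_of_hasSum_pow_smul (a := laguerreCoeff n κ (hermiteOp κ h))
    (b := fun k => (κ * (2 * k + n)) • laguerreCoeff n κ h k) (ε := 1) one_pos
    (g := fun r => ∫ p : V × ℝ, mehlerFun n κ r p.1 • hermiteOp κ h p) ?_ ?_) k
  · intro r hr
    exact hasSum_integral_smul (SchwartzMap.integrable _) hc (fun k p => hb k p.1)
      (summable_abs_pow_mul_degree_pow n n hr) fun p => hasSum_laguerreFun hn κ p.1 hr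
  · intro r hr
    have hS := hasSum_integral_smul (r := r) (μ := (volume : Measure (V × ℝ))) h.integrable
      (u := fun k p => κ * ((2 * k + n) * laguerreFun n k κ p.1))
      (S := fun p => κ * ((n * ((1 + r) / (1 - r)) - κ * ‖p.1‖ ^ 2 * (r / (1 - r) ^ 2)) *
        mehlerFun n κ r p.1))
      (B := fun k => κ * (2 * k + n) ^ (n + 1)) (fun k => ((hc k).const_mul _).const_mul _)
      (fun k p => ?_) ?_ fun p => ?_
    · rw [integral_mehlerFun_smul_hermiteOp hdim hκ.le hr]
      refine hS.congr_fun fun k => ?_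
      rw [laguerreCoeff, ← integral_smul]
      simp only [smul_smul, mul_assoc]
    · rw [abs_mul, abs_mul, abs_of_pos hκ, abs_of_nonneg (by positivity : (0 : ℝ) ≤ 2 * k + n),
        pow_succ']
      have := hb k p.1
      gcongr
    · refine ((summable_abs_pow_mul_degree_pow n (n + 1) hr).mul_left κ).congr fun k => ?_
      ring
    · convert! (hasSum_degree_mul_laguerreFun hn κ p.1 hr).mul_left κ using 2
      ring

theorem norm_laguerreCoeff_le {n : ℕ} (hn : 1 ≤ n) (hdim : Module.finrank ℝ V = 2 * n)
    (hperp : ∀ x : V, ∃ w : V, inner ℝ x w = 0 ∧ ‖w‖ = ‖x‖) {κ : ℝ} (hκ : 0 < κ)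
    (h : 𝓢(V × ℝ, ℂ)) (k : ℕ) :
    ‖laguerreCoeff n κ h k‖ ≤ (2 * k + n) ^ n * ∫ p, ‖h p‖ := by
  rw [← integral_const_mul]
  refine norm_integral_le_of_norm_le (h.integrable.norm.const_mul _)
    (Eventually.of_forall fun p => ?_)
  rw [norm_smul, Real.norm_eq_abs]
  gcongr
  exact abs_laguerreFun_le_degree_pow_of_forall hn hdim hperp hκ k p.1

theorem laguerreCoeff_iterate_hermiteOp {n : ℕ} (hn : 1 ≤ n) (hdim : Module.finrank ℝ V = 2 * n)
    (hperp : ∀ x : V, ∃ w : V, inner ℝ x w = 0 ∧ ‖w‖ = ‖x‖) {κ : ℝ} (hκ : 0 < κ)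
    (h : 𝓢(V × ℝ, ℂ)) (k m : ℕ) :
    laguerreCoeff n κ ((hermiteOp κ)^[m] h) k =
      (κ * (2 * k + n)) ^ m • laguerreCoeff n κ h k := by
  induction m with
  | zero => simp
  | succ m ih =>
    rw [Function.iterate_succ_apply', laguerreCoeff_hermiteOp hn hdim hperp hκ, ih, smul_smul,
      pow_succ']

theorem summable_laguerreCoeff {n : ℕ} (hn : 1 ≤ n) (hdim : Module.finrank ℝ V = 2 * n)
    (hperp : ∀ x : V, ∃ w : V, inner ℝ x w = 0 ∧ ‖w‖ = ‖x‖) {κ : ℝ} (hκ : 0 < κ)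
    (h : 𝓢(V × ℝ, ℂ)) : Summable (laguerreCoeff n κ h) := by
  set M : ℝ := ∫ p, ‖(hermiteOp κ)^[n + 2] h p‖
  have hM : 0 ≤ M := integral_nonneg fun p => norm_nonneg _
  have hs : Summable fun k : ℕ => M / κ ^ (n + 2) * (((k + 1 : ℕ) : ℝ) ^ 2)⁻¹ :=
    ((summable_nat_add_iff 1).2 (Real.summable_nat_pow_inv.2 one_lt_two)).mul_left _
  refine Summable.of_norm_bounded hs fun k => ?_
  have h1 := norm_laguerreCoeff_le hn hdim hperp hκ ((hermiteOp κ)^[n + 2] h) k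
  have hd : (0 : ℝ) < 2 * k + n := by positivity
  rw [laguerreCoeff_iterate_hermiteOp hn hdim hperp hκ, norm_smul, norm_pow, norm_mul,
    Real.norm_of_nonneg hκ.le, Real.norm_of_nonneg hd.le] at h1
  have h2 : ‖laguerreCoeff n κ h k‖ ≤ M / κ ^ (n + 2) * ((2 * k + n : ℝ) ^ 2)⁻¹ := by
    rw [← div_eq_mul_inv, div_div, le_div_iff₀ (by positivity)]
    refine le_of_mul_le_mul_left ?_ (pow_pos hd n)
    refine le_trans (le_of_eq ?_) h1
    rw [mul_pow]
    ring
  refine h2.trans ?_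
  have : (1 : ℝ) ≤ n := by exact_mod_cast hn
  have : ((k + 1 : ℕ) : ℝ) ≤ 2 * k + n := by
    push_cast
    linarith [(Nat.cast_nonneg k : (0:ℝ) ≤ k)]
  gcongr

theorem hasSum_laguerreCoeff {n : ℕ} (hn : 1 ≤ n) (hdim : Module.finrank ℝ V = 2 * n)
    (hperp : ∀ x : V, ∃ w : V, inner ℝ x w = 0 ∧ ‖w‖ = ‖x‖) {κ : ℝ} (hκ : 0 < κ)
    (h : 𝓢(V × ℝ, ℂ)) :
    HasSum (laguerreCoeff n κ h) ((((2 * π / κ) ^ n : ℝ) : ℂ) * ∫ t : ℝ, h (0, t)) := by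
  have hsum := summable_laguerreCoeff hn hdim hperp hκ h
  have habel := Complex.tendsto_tsum_powerSeries_nhdsWithin_lt hsum.hasSum.tendsto_sum_nat
  rw [tendsto_map'_iff] at habel
  have hint : Integrable (h : V × ℝ → ℂ) ((volume : Measure V).prod volume) := h.integrable
  have hlim := tendsto_integral_mehlerFun_mul (n := n) hdim hκ (G := fun y => ∫ t : ℝ, h (y, t))
    hint.integral_prod_left (continuous_integral_snd h).continuousAt
  have heq : (fun r : ℝ => ∫ y, (mehlerFun n κ r y : ℂ) * ∫ t : ℝ, h (y, t))
      =ᶠ[nhdsWithin 1 (Set.Iio 1)] (fun z : ℂ => ∑' k, laguerreCoeff n κ h k * z ^ k) ∘ ofReal := by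
    have : Set.Ioo (-1 : ℝ) 1 ∈ nhdsWithin 1 (Set.Iio 1) := Ioo_mem_nhdsLT (by norm_num)
    filter_upwards [this] with r hr'
    have hr : |r| < 1 := abs_lt.2 hr'
    have hS := hasSum_integral_smul (r := r) (μ := (volume : Measure (V × ℝ))) h.integrable
      (fun k => ((continuous_laguerreFun n k κ).comp continuous_fst).aestronglyMeasurable)
      (fun k p => abs_laguerreFun_le_degree_pow_of_forall hn hdim hperp hκ k p.1)
      (summable_abs_pow_mul_degree_pow n n hr) fun p => hasSum_laguerreFun hn κ p.1 hr
    have e1 : ∫ p : V × ℝ, mehlerFun n κ r p.1 • h p =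
        ∫ y, (mehlerFun n κ r y : ℂ) * ∫ t : ℝ, h (y, t) := by
      have hi : Integrable (fun p : V × ℝ => mehlerFun n κ r p.1 • h p) := by
        simpa using integrable_mehlerFun_mul_smul n hκ.le hr (g := fun _ => 1) (by fun_prop) h
      refine (integral_prod _ hi).trans ?_
      simp only [real_smul, integral_const_mul]
    rw [← e1, ← hS.tsum_eq, Function.comp_apply]
    refine tsum_congr fun k => ?_
    rw [laguerreCoeff, real_smul, ofReal_pow, mul_comm]
    rfl
  rw [tendsto_nhds_unique (hlim.congr' heq) habel]
  exact hsum.hasSum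

end Expansion

section Schwartz
open scoped SchwartzMap FourierTransform

theorem hasTemperateGrowth_cexp_I_mul : (fun t : ℝ => cexp (I * t)).HasTemperateGrowth := by
  have hd (t : ℝ) : HasDerivAt (fun t : ℝ => cexp (I * t)) (I * cexp (I * t)) t := by
    simpa [mul_comm] using ((hasDerivAt_id t).ofReal_comp.const_mul I).cexp
  have hi (k : ℕ) : iteratedDeriv k (fun t : ℝ => cexp (I * t)) =
      fun t : ℝ => I ^ k * cexp (I * t) := by
    induction k with
    | zero => simp
    | succ k ih =>
      rw [iteratedDeriv_succ, ih]
      ext t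
      rw [((hd t).const_mul _).deriv, pow_succ, mul_assoc]
  refine ⟨(contDiff_const.mul ofRealCLM.contDiff).cexp, fun k => ⟨0, 1, fun t => ?_⟩⟩
  rw [norm_iteratedFDeriv_eq_norm_iteratedDeriv, hi, norm_mul, norm_pow, norm_I, one_pow,
    mul_comm I, norm_exp_ofReal_mul_I]
  simp

theorem exists_schwartzMap_modulated_reflection {V : Type*} [NormedAddCommGroup V]
    [NormedSpace ℝ V] (f : 𝓢(V × ℝ, ℂ)) (z : V) (ℓ : V × ℝ →L[ℝ] ℝ) :
    ∃ h : 𝓢(V × ℝ, ℂ), ∀ p, h p = cexp (I * (ℓ p : ℝ)) * f (z - p.1, p.2) := by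
  have hg : (fun p : V × ℝ => (z - p.1, p.2)).HasTemperateGrowth := by
    have h1 : (fun p : V × ℝ => (-p.1, p.2)).HasTemperateGrowth :=
      ((-ContinuousLinearMap.fst ℝ V ℝ).prod (ContinuousLinearMap.snd ℝ V ℝ)).hasTemperateGrowth
    have h2 := (Function.HasTemperateGrowth.const (E := V × ℝ) ((z, 0) : V × ℝ)).add h1
    convert h2 using 1
    ext p <;> simp [sub_eq_add_neg]
  have ha : AntilipschitzWith 1 (fun p : V × ℝ => (z - p.1, p.2)) :=
    AntilipschitzWith.of_le_mul_dist fun p q => by simp only [Prod.dist_eq, dist_sub_left]; simp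
  have he : (fun p => cexp (I * (ℓ p : ℝ))).HasTemperateGrowth :=
    hasTemperateGrowth_cexp_I_mul.comp ℓ.hasTemperateGrowth
  refine ⟨SchwartzMap.smulLeftCLM ℂ (fun p => cexp (I * (ℓ p : ℝ)))
    (SchwartzMap.compCLMOfAntilipschitz ℝ hg ha f), fun p => ?_⟩
  rw [SchwartzMap.smulLeftCLM_apply_apply he]
  rfl

theorem exists_schwartzMap_snd {V : Type*} [NormedAddCommGroup V] [NormedSpace ℝ V]
    (f : 𝓢(V × ℝ, ℂ)) (z : V) : ∃ g : 𝓢(ℝ, ℂ), ∀ s, g s = f (z, s) := by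
  have hg : (fun s : ℝ => (z, s)).HasTemperateGrowth := by
    have h2 := (Function.HasTemperateGrowth.const (E := ℝ) ((z, 0) : V × ℝ)).add
      (ContinuousLinearMap.inr ℝ V ℝ).hasTemperateGrowth
    convert h2 using 1
    ext p <;> simp
  have ha : AntilipschitzWith 1 (fun s : ℝ => (z, s)) :=
    AntilipschitzWith.of_le_mul_dist fun p q => by simp [Prod.dist_eq]
  exact ⟨SchwartzMap.compCLMOfAntilipschitz ℝ hg ha f, fun s => rfl⟩

theorem SchwartzMap.inversion_exp (g : 𝓢(ℝ, ℂ)) (t : ℝ) :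
    ∫ lam : ℝ, cexp (I * lam * t) * ∫ s : ℝ, cexp (-(I * lam * s)) * g s = 2 * π * g t := by
  have hg : 𝓕⁻ (𝓕 g : 𝓢(ℝ, ℂ)) = g := FourierTransform.fourierInv_fourier_eq g
  have h0 := congrArg (fun h : 𝓢(ℝ, ℂ) => h t) hg
  simp only [SchwartzMap.fourierInv_coe, SchwartzMap.fourier_coe] at h0
  rw [← h0, Real.fourierInv_eq']
  have h1 := Measure.integral_comp_mul_left
    (fun lam : ℝ => cexp (I * lam * t) * ∫ s : ℝ, cexp (-(I * lam * s)) * g s) (2 * π)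
  have hπ : 0 < 2 * π := by positivity
  rw [abs_of_pos (inv_pos.2 hπ), eq_inv_smul_iff₀ hπ.ne'] at h1
  rw [← h1, real_smul]
  push_cast
  congr 1
  refine integral_congr_ae (Eventually.of_forall fun v => ?_)
  simp only
  rw [Real.fourier_eq', smul_eq_mul]
  congr 1
  · congr 1
    simp
    ring
  · congr 1
    ext s
    rw [smul_eq_mul]
    congr 2
    simp
    ring

end Schwartz

section Heisenberg
variable {n : ℕ}

theorem imZW_eq_inner (z w : Cn n) : imZW z w = inner ℝ z (I • w) := by
  have : (inner ℝ z (I • w) : ℝ) = (inner ℂ z (I • w)).re := rfl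
  rw [this, inner_smul_right, I_mul_re, ← conj_im, imZW, PiLp.inner_apply, map_sum]
  simp [mul_comm]

theorem continuous_imZW {X : Type*} [TopologicalSpace X] {a b : X → Cn n} (ha : Continuous a)
    (hb : Continuous b) : Continuous fun x => imZW (a x) (b x) := by
  simp only [imZW_eq_inner]
  exact ha.inner (hb.const_smul I)

theorem imZW_self (z : Cn n) : imZW z z = 0 := by
  simp [imZW, mul_conj]

theorem imZW_swap (z w : Cn n) : imZW w z = -imZW z w := by
  rw [imZW, imZW, ← conj_im, map_sum]
  simp [mul_comm]

theorem imZW_add_left (z z' w : Cn n) : imZW (z + z') w = imZW z w + imZW z' w := by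
  simp only [imZW_eq_inner, inner_add_left]

theorem imZW_sub_right (z w w' : Cn n) : imZW z (w - w') = imZW z w - imZW z w' := by
  simp only [imZW_eq_inner, smul_sub, inner_sub_right]

theorem exists_inner_eq_zero_norm_eq (x : Cn n) : ∃ w : Cn n, inner ℝ x w = 0 ∧ ‖w‖ = ‖x‖ :=
  ⟨I • x, by rw [← imZW_eq_inner, imZW_self], by simp [norm_smul]⟩

theorem finrank_real_Cn : Module.finrank ℝ (Cn n) = 2 * n := by
  rw [finrank_real_of_complex, finrank_euclideanSpace_fin]

theorem lagFun_eq_laguerreFun (k : ℕ) (lam : ℝ) (z : Cn n) :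
    lagFun n k lam z = laguerreFun n k |lam| z := rfl

end Heisenberg

section Inversion
open scoped SchwartzMap
variable {n : ℕ}

theorem continuous_lagFun (k : ℕ) (lam : ℝ) : Continuous fun z : Cn n => lagFun n k lam z :=
  continuous_laguerreFun n k |lam|

theorem integrable_lagFun (hn : 1 ≤ n) (k : ℕ) {lam : ℝ} (hlam : lam ≠ 0) :
    Integrable fun z : Cn n => lagFun n k lam z :=
  integrable_laguerreFun hn k (abs_pos.2 hlam)

theorem abs_lagFun_le (hn : 1 ≤ n) (k : ℕ) {lam : ℝ} (hlam : lam ≠ 0) (z : Cn n) :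
    |lagFun n k lam z| ≤ (2 * k + n) ^ n :=
  abs_laguerreFun_le_degree_pow_of_forall hn finrank_real_Cn exists_inner_eq_zero_norm_eq
    (abs_pos.2 hlam) k z

/-- The reproducing property of the Laguerre functions under twisted convolution, translated to
arbitrary base points. -/
theorem integral_lagFun_mul_lagFun_twisted (hn : 1 ≤ n) (k : ℕ) {lam : ℝ} (hlam : lam ≠ 0)
    (z v : Cn n) :
    ∫ w : Cn n, (lagFun n k lam (w - v) : ℂ) * (lagFun n k lam (z - w) : ℂ) *
      cexp (I / 2 * lam * ((imZW w v - imZW w z : ℝ) : ℂ)) =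
    (((2 * π / |lam|) ^ n : ℝ) : ℂ) * (lagFun n k lam (z - v) : ℂ) *
      cexp (I / 2 * lam * (imZW z v : ℂ)) := by
  rw [← integral_add_left_eq_self _ v]
  have h := integral_laguerreFun_mul_laguerreFun_twisted (V := Cn n) hn finrank_real_Cn hlam k
    (x := z - v) (w := I • (z - v)) (by rw [← imZW_eq_inner, imZW_self]) (by simp [norm_smul])
  rw [lagFun_eq_laguerreFun, ← ofReal_mul, ← h, ← integral_mul_const]
  refine integral_congr_ae (Eventually.of_forall fun y => ?_)
  simp only [lagFun_eq_laguerreFun]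
  rw [add_sub_cancel_left, ← sub_sub, ofReal_mul, mul_assoc _ (cexp _) (cexp _), ← Complex.exp_add,
    real_inner_comm, ← imZW_eq_inner, imZW_add_left, imZW_add_left, imZW_self, imZW_sub_right,
    imZW_swap z v]
  congr 2
  push_cast
  ring

theorem stri_eq (f : Hn n → ℂ) (k : ℕ) (lam : ℝ) (w : Cn n) :
    stri n f k lam w = ∫ v : Cn n, fLam n f (-lam) v *
      ((lagFun n k lam (w - v) : ℂ) * cexp (I / 2 * lam * (imZW w v : ℂ))) := by
  rw [stri, twConv, ← integral_sub_left_eq_self _ _ w]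
  refine integral_congr_ae (Eventually.of_forall fun v => ?_)
  simp only
  rw [sub_sub_cancel, imZW_sub_right, imZW_self, mul_assoc]
  congr 3
  push_cast
  ring

theorem integral_stri_mul_lagFun (hn : 1 ≤ n) {f : Hn n → ℂ} (k : ℕ) {lam : ℝ} (hlam : lam ≠ 0)
    (hf : Integrable (fLam n f (-lam))) (z : Cn n) (t : ℝ) :
    ∫ w : Cn n, stri n f k lam w * cexp (I * lam * ((t - imZW w z / 2 : ℝ) : ℂ)) *
      (lagFun n k lam (z - w) : ℂ) =
    cexp (I * lam * t) * ((((2 * π / |lam|) ^ n : ℝ) : ℂ) *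
      ∫ y : Cn n, lagFun n k lam y •
        (fLam n f (-lam) (z - y) * cexp (-(I / 2 * lam * (imZW z y : ℂ))))) := by
  have hc := continuous_lagFun (n := n) k lam
  have hcw : Continuous fun p : Cn n × Cn n => imZW p.1 p.2 :=
    continuous_imZW continuous_fst continuous_snd
  have hcz : Continuous fun w : Cn n => imZW w z := continuous_imZW continuous_id continuous_const
  have hphase (a : ℝ) : ‖cexp (I / 2 * lam * a)‖ = 1 := by
    rw [show I / 2 * lam * a = ((lam * a / 2 : ℝ) : ℂ) * I by push_cast; ring,
      norm_exp_ofReal_mul_I]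
  have hint : Integrable (fun p : Cn n × Cn n =>
      ((lagFun n k lam (p.1 - p.2) : ℂ) *
        cexp (I / 2 * lam * ((imZW p.1 p.2 - imZW p.1 z : ℝ) : ℂ))) *
      ((lagFun n k lam (z - p.1) : ℂ) * fLam n f (-lam) p.2)) := by
    refine Integrable.bdd_mul (c := (2 * k + n) ^ n) ?_ ?_ (Eventually.of_forall fun p => ?_)
    · exact ((integrable_lagFun hn k hlam).comp_sub_left z).ofReal.mul_prod hf
    · have h1 : Continuous fun p : Cn n × Cn n => lagFun n k lam (p.1 - p.2) :=
        hc.comp (continuous_fst.sub continuous_snd)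
      have h2 : Continuous fun p : Cn n × Cn n => imZW p.1 z := hcz.comp continuous_fst
      exact Continuous.aestronglyMeasurable (by fun_prop)
    · rw [norm_mul, hphase, mul_one, norm_real]
      exact abs_lagFun_le hn k hlam _
  calc _ = ∫ w : Cn n, ∫ v : Cn n, cexp (I * lam * t) * (((lagFun n k lam (w - v) : ℂ) *
        cexp (I / 2 * lam * ((imZW w v - imZW w z : ℝ) : ℂ))) *
      ((lagFun n k lam (z - w) : ℂ) * fLam n f (-lam) v)) := by
        refine integral_congr_ae (Eventually.of_forall fun w => ?_)
        simp only
        rw [stri_eq, ← integral_mul_const, ← integral_mul_const]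
        refine integral_congr_ae (Eventually.of_forall fun v => ?_)
        simp only
        have e : cexp (I / 2 * lam * (imZW w v : ℂ)) *
            cexp (I * lam * ((t - imZW w z / 2 : ℝ) : ℂ)) = cexp (I * lam * t) *
            cexp (I / 2 * lam * ((imZW w v - imZW w z : ℝ) : ℂ)) := by
          rw [← Complex.exp_add, ← Complex.exp_add]
          congr 1
          push_cast
          ring
        linear_combination (fLam n f (-lam) v * (lagFun n k lam (w - v) : ℂ) *
          (lagFun n k lam (z - w) : ℂ)) * e
    _ = ∫ v : Cn n, cexp (I * lam * t) * ((((2 * π / |lam|) ^ n : ℝ) : ℂ) *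
          (lagFun n k lam (z - v) • (fLam n f (-lam) v * cexp (I / 2 * lam * (imZW z v : ℂ))))) := by
        rw [integral_integral_swap (hint.const_mul _)]
        refine integral_congr_ae (Eventually.of_forall fun v => ?_)
        simp only
        rw [integral_const_mul]
        congr 1
        have h := congrArg (fun a => a * fLam n f (-lam) v)
          (integral_lagFun_mul_lagFun_twisted hn k hlam z v)
        simp only [← integral_mul_const] at h
        rw [real_smul]
        convert! h using 1
        · refine integral_congr_ae (Eventually.of_forall fun w => ?_)
          simp only
          ring
        · ring
    _ = _ := by
        rw [integral_const_mul, integral_const_mul, ← integral_sub_left_eq_self _ _ z]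
        congr 3
        ext y
        rw [sub_sub_cancel, imZW_sub_right, imZW_self]
        congr 3
        push_cast
        ring

/-- The pointwise twisted Laguerre expansion at a fixed frequency. -/
theorem hasSum_integral_stri (hn : 1 ≤ n) (f : 𝓢(Hn n, ℂ)) {lam : ℝ} (hlam : lam ≠ 0)
    (z : Cn n) (t : ℝ) :
    HasSum (fun k => ∫ w : Cn n, stri n f k lam w *
        cexp (I * lam * ((t - imZW w z / 2 : ℝ) : ℂ)) * (lagFun n k lam (z - w) : ℂ))
      (cexp (I * lam * t) * ((((2 * π / |lam|) ^ n : ℝ) : ℂ) *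
        ((((2 * π / |lam|) ^ n : ℝ) : ℂ) * fLam n f (-lam) z))) := by
  have hκ := abs_pos.2 hlam
  let ℓ : Cn n × ℝ →L[ℝ] ℝ := -(lam • (ContinuousLinearMap.snd ℝ (Cn n) ℝ +
    (1 / 2 : ℝ) • -((innerSL ℝ (I • z)).comp (ContinuousLinearMap.fst ℝ (Cn n) ℝ))))
  have hℓ (y : Cn n) (s : ℝ) : ℓ (y, s) = -(lam * (s + imZW z y / 2)) := by
    have : (inner ℝ (I • z) y : ℝ) = -imZW z y := by
      rw [real_inner_comm, ← imZW_eq_inner, imZW_swap]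
    simp [ℓ, this]
    ring
  obtain ⟨h, hh⟩ := exists_schwartzMap_modulated_reflection (V := Cn n) f z ℓ
  obtain ⟨g, hg⟩ := exists_schwartzMap_modulated_reflection (V := Cn n) f 0
    (-(lam • ContinuousLinearMap.snd ℝ (Cn n) ℝ))
  have hgi : Integrable (g : Cn n × ℝ → ℂ) ((volume : Measure (Cn n)).prod volume) := g.integrable
  have hF : Integrable (fLam n f (-lam)) := by
    have h1 := hgi.integral_prod_left.comp_sub_left 0
    convert! h1 using 1
    ext y
    rw [fLam]
    congr 1
    ext s
    simp [hg, mul_assoc]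
  have hG (y : Cn n) : ∫ s, h (y, s) =
      fLam n f (-lam) (z - y) * cexp (-(I / 2 * lam * (imZW z y : ℂ))) := by
    rw [fLam, ← integral_mul_const]
    refine integral_congr_ae (Eventually.of_forall fun s => ?_)
    simp only
    rw [hh, hℓ, mul_right_comm, ← Complex.exp_add]
    congr 2
    push_cast
    ring
  have hcoeff (k : ℕ) : laguerreCoeff n |lam| h k = ∫ y : Cn n, lagFun n k lam y •
      (fLam n f (-lam) (z - y) * cexp (-(I / 2 * lam * (imZW z y : ℂ)))) := by
    have hi : Integrable (fun p : Cn n × ℝ => laguerreFun n k |lam| p.1 • h p)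
        ((volume : Measure (Cn n)).prod volume) := by
      refine Integrable.bdd_smul (φ := fun p : Cn n × ℝ => laguerreFun n k |lam| p.1) h.integrable
        ((2 * k + n) ^ n) ?_ (Eventually.of_forall fun p => abs_lagFun_le hn k hlam p.1)
      exact ((continuous_lagFun k lam).comp continuous_fst).aestronglyMeasurable
    refine (integral_prod _ hi).trans ?_
    simp only [integral_smul, hG]
    rfl
  have hs := hasSum_laguerreCoeff hn finrank_real_Cn exists_inner_eq_zero_norm_eq hκ h
  have hz : imZW z 0 = 0 := by rw [imZW_eq_inner, smul_zero, inner_zero_right]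
  rw [hG, sub_zero, hz, ofReal_zero, mul_zero, neg_zero, Complex.exp_zero, mul_one] at hs
  refine ((hs.mul_left (((2 * π / |lam|) ^ n : ℝ) : ℂ)).mul_left (cexp (I * lam * t))).congr_fun
    fun k => ?_
  rw [integral_stri_mul_lagFun hn k hlam hF, hcoeff]

end Inversion

/-- **Inversion formula for the Strichartz Fourier transform** (explicit form):
f(z,t) = (2π)^{−2n−1} ∫_ℝ ∑_k (∫ f̂((λ,(2k+n)|λ|),w) e^{iλ(t−(1/2)Im(w·z̄))} φ_{k,λ}(z−w) dw)
|λ|^{2n} dλ for Schwartz functions f. -/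
theorem strichartz_inversion (n : ℕ) (hn : 1 ≤ n) (f : SchwartzMap (Hn n) ℂ)
    (z : Cn n) (t : ℝ) :
    f (z, t) = ((((2 * π) ^ (2 * n + 1))⁻¹ : ℝ) : ℂ) *
      ∫ lam : ℝ, (∑' k : ℕ, ∫ w : Cn n,
        stri n (⇑f) k lam w *
          Complex.exp (Complex.I * (lam : ℂ) * (((t - imZW w z / 2 : ℝ)) : ℂ)) *
          ((lagFun n k lam (z - w) : ℝ) : ℂ)) * ((|lam| ^ (2 * n) : ℝ) : ℂ) := by
  obtain ⟨g, hg⟩ := exists_schwartzMap_snd (V := Cn n) f z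
  have hinv := SchwartzMap.inversion_exp g t
  have hae : ∀ᵐ lam : ℝ, (∑' k : ℕ, ∫ w : Cn n,
        stri n (⇑f) k lam w *
          Complex.exp (Complex.I * (lam : ℂ) * (((t - imZW w z / 2 : ℝ)) : ℂ)) *
          ((lagFun n k lam (z - w) : ℝ) : ℂ)) * ((|lam| ^ (2 * n) : ℝ) : ℂ) =
      (((2 * π) ^ (2 * n) : ℝ) : ℂ) *
        (cexp (I * lam * t) * ∫ s : ℝ, cexp (-(I * lam * s)) * g s) := by
    filter_upwards [Measure.ae_ne volume 0] with lam hlam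
    have hF : fLam n f (-lam) z = ∫ s : ℝ, cexp (-(I * lam * s)) * g s := by
      simp [fLam, hg]
    rw [(hasSum_integral_stri hn f hlam z t).tsum_eq, hF]
    have h0 : ((|lam| : ℝ) : ℂ) ≠ 0 := by simpa using hlam
    push_cast
    rw [two_mul n, pow_add, pow_add, div_pow]
    field_simp
  rw [integral_congr_ae hae, integral_const_mul, hinv, hg]
  have hπ : (π : ℂ) ≠ 0 := by simp
  push_cast
  rw [pow_succ]
  field_simp
end
end

section
/- For every Schwartz function f on ℍⁿ and every (z,t) ∈ ℍⁿ, f(z,t) = (2π)^{−n−1} ∫_ℝ e^{iλt} ( Σ_{k=0}^∞ f̂((λ,(2k+n)|λ|), z) ) |λ|^n dλ. -/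
open MeasureTheory Complex Real Filter

noncomputable section

theorem hasSum_lagPoly_mul_pow {n : ℕ} (hn : 1 ≤ n) (s : ℝ) {r : ℂ} (hr : ‖r‖ < 1) :
    HasSum (fun k => (lagPoly n k s : ℂ) * r ^ k)
      (((1 - r) ^ n)⁻¹ * Complex.exp (-(s * r / (1 - r)))) := by
  obtain ⟨m, rfl⟩ : ∃ m, n = m + 1 := ⟨n - 1, by omega⟩
  have h1r : (1 - r) ≠ 0 := by
    intro h
    have : r = 1 := by linear_combination -h
    simp [this] at hr
  set F : ℕ × ℕ → ℂ := fun p =>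
    ((-(s : ℂ)) ^ p.1 / p.1.factorial * r ^ p.1) *
      (((p.2 + (p.1 + m)).choose (p.1 + m) : ℂ) * r ^ p.2) with hF
  have hfib : ∀ j, HasSum (fun i => F (j, i))
      (((1 - r) ^ (m + 1))⁻¹ * ((-(s * r / (1 - r))) ^ j / j.factorial)) := by
    intro j
    have := (hasSum_choose_mul_geometric_of_norm_lt_one (j + m) hr).mul_left
      ((-(s : ℂ)) ^ j / j.factorial * r ^ j)
    have e : ((1 - r) ^ (m + 1))⁻¹ * ((-(s * r / (1 - r))) ^ j / j.factorial) =
        (-(s : ℂ)) ^ j / j.factorial * r ^ j * (1 / (1 - r) ^ (j + m + 1)) := by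
      rw [neg_pow, div_pow, mul_pow, neg_pow (s : ℂ)]
      field_simp
      ring
    rw [e]
    exact this
  have hsum : Summable F := by
    apply Summable.of_norm
    rw [summable_prod_of_nonneg (fun _ => norm_nonneg _)]
    have hr' : ‖‖r‖‖ < 1 := by simpa using hr
    have hfib' : ∀ j, HasSum (fun i => ‖F (j, i)‖)
        (((1 - ‖r‖) ^ (m + 1))⁻¹ * ((|s| * ‖r‖ / (1 - ‖r‖)) ^ j / j.factorial)) := by
      intro j
      have := (hasSum_choose_mul_geometric_of_norm_lt_one (j + m) hr').mul_left
        (|s| ^ j / j.factorial * ‖r‖ ^ j)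
      have h1 : (1 - ‖r‖) ≠ 0 := by linarith
      have e : ((1 - ‖r‖) ^ (m + 1))⁻¹ * ((|s| * ‖r‖ / (1 - ‖r‖)) ^ j / j.factorial) =
          |s| ^ j / j.factorial * ‖r‖ ^ j * (1 / (1 - ‖r‖) ^ (j + m + 1)) := by
        rw [div_pow, mul_pow]
        field_simp
        ring
      rw [e]
      refine this.congr_fun fun i => ?_
      simp [F]
    refine ⟨fun j => (hfib' j).summable, ?_⟩
    simp_rw [fun j => (hfib' j).tsum_eq]
    exact (Real.summable_pow_div_factorial _).mul_left _
  have htot : HasSum F (((1 - r) ^ (m + 1))⁻¹ * Complex.exp (-(s * r / (1 - r)))) := by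
    have h1 := hsum.hasSum.prod_fiberwise hfib
    have h2 : HasSum (fun j : ℕ => (-(s * r / (1 - r))) ^ j / (j.factorial : ℂ))
        (Complex.exp (-(s * r / (1 - r)))) := by
      rw [Complex.exp_eq_exp_ℂ]
      exact NormedSpace.expSeries_div_hasSum_exp _
    have := h1.unique (h2.mul_left ((1 - r) ^ (m + 1))⁻¹)
    rw [← this]
    exact hsum.hasSum
  rw [← Finset.HasAntidiagonal.sigmaAntidiagonalEquivProd.hasSum_iff] at htot
  have := htot.sigma (fun k => hasSum_fintype _)
  have e : (fun k => (lagPoly (m + 1) k s : ℂ) * r ^ k) = fun k =>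
      ∑ b : Finset.HasAntidiagonal.antidiagonal k,
        (F ∘ Finset.HasAntidiagonal.sigmaAntidiagonalEquivProd) ⟨k, b⟩ := by
    ext k
    simp only [Function.comp_apply, Finset.HasAntidiagonal.sigmaAntidiagonalEquivProd_apply]
    rw [Finset.univ_eq_attach, Finset.sum_attach (Finset.HasAntidiagonal.antidiagonal k) F,
      Finset.Nat.sum_antidiagonal_eq_sum_range_succ_mk, lagPoly]
    push_cast
    rw [Finset.sum_mul]
    refine Finset.sum_congr rfl fun j hj => ?_
    have hj' : j ≤ k := Nat.lt_succ_iff.1 (Finset.mem_range.1 hj)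
    simp only [F]
    have h1 : k + (m + 1) - 1 = (k - j) + (j + m) := by omega
    have h2 : r ^ k = r ^ j * r ^ (k - j) := by rw [← pow_add]; congr 1; omega
    rw [h1, Nat.choose_symm_add, h2]
    ring
  rw [e]
  exact this

theorem norm_coeff_le_of_hasSum {c : ℕ → ℂ} {f : ℂ → ℂ}
    (hf : ∀ r : ℂ, ‖r‖ < 1 → HasSum (fun k => c k * r ^ k) (f r))
    {ρ C : ℝ} (hρ0 : 0 < ρ) (hρ1 : ρ < 1) (hC : ∀ r : ℂ, ‖r‖ = ρ → ‖f r‖ ≤ C) (k : ℕ) :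
    ‖c k‖ ≤ C / ρ ^ k := by
  have hps : HasFPowerSeriesOnBall f (FormalMultilinearSeries.ofScalars ℂ c) 0 1 := by
    refine ⟨?_, one_pos, ?_⟩
    · refine ENNReal.le_of_forall_nnreal_lt fun q hq => ?_
      have hq' : ‖(q : ℂ)‖ < 1 := by simpa using hq
      refine FormalMultilinearSeries.le_radius_of_summable_norm _ ?_
      have := (hf q hq').summable.norm
      refine this.congr fun k => ?_
      simp
    · intro y hy
      have hy' : ‖y‖ < 1 := by
        have h : edist y 0 < ENNReal.ofReal 1 := by simpa using hy
        simpa using edist_lt_ofReal.1 h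
      rw [zero_add]
      refine (hf y hy').congr_fun fun k => ?_
      simp [mul_comm]
  have hdiff : DiffContOnCl ℂ f (Metric.ball 0 ρ) := by
    refine DifferentiableOn.diffContOnCl ?_
    rw [closure_ball _ hρ0.ne']
    refine hps.differentiableOn.mono fun y hy => ?_
    have : ‖y‖ ≤ ρ := by simpa using hy
    have : ‖y‖ < 1 := by linarith
    have h : edist y 0 < ENNReal.ofReal 1 := edist_lt_ofReal.2 (by simpa using this)
    simpa using h
  have h1 := Complex.norm_iteratedDeriv_le_of_forall_mem_sphere_norm_le k hρ0 hdiff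
    (fun z hz => hC z (by simpa using hz))
  have h2 : iteratedDeriv k f 0 = k.factorial * c k := by
    have := hps.factorial_smul 1 k
    rw [iteratedDeriv_eq_iteratedFDeriv, ← this]
    simp
  rw [h2, norm_mul, mul_div_assoc] at h1
  simp only [Complex.norm_natCast] at h1
  exact le_of_mul_le_mul_left h1 (by positivity)

theorem abs_lagPoly_mul_exp_le {n : ℕ} (hn : 1 ≤ n) (k : ℕ) {s : ℝ} (hs : 0 ≤ s) :
    |lagPoly n k s * Real.exp (-(s / 2))| ≤ 3 * (k + 2) ^ n := by
  set ρ : ℝ := (k + 1) / (k + 2) with hρ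
  have hρ0 : 0 < ρ := by positivity
  have hρ1 : ρ < 1 := by rw [hρ, div_lt_one (by positivity)]; linarith
  have key := norm_coeff_le_of_hasSum (c := fun k => ((lagPoly n k s * Real.exp (-(s / 2)) : ℝ) : ℂ))
    (f := fun r => ((1 - r) ^ n)⁻¹ * Complex.exp (-(s * r / (1 - r))) * Complex.exp (-(s / 2)))
    (C := ((1 - ρ) ^ n)⁻¹) ?_ hρ0 hρ1 ?_ k
  · rw [Complex.norm_real, Real.norm_eq_abs] at key
    refine key.trans ?_
    have h1 : 1 - ρ = (k + 2 : ℝ)⁻¹ := by rw [hρ]; field_simp; ring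
    have h2 : (ρ ^ k)⁻¹ ≤ 3 := by
      have h3 : ρ⁻¹ ≤ Real.exp (1 / (k + 1)) := by
        have := Real.add_one_le_exp (1 / (k + 1 : ℝ))
        refine le_trans (le_of_eq ?_) this
        rw [hρ]; field_simp; ring
      rw [← inv_pow]
      calc ρ⁻¹ ^ k ≤ Real.exp (1 / (k + 1)) ^ k := by gcongr
        _ = Real.exp (k / (k + 1)) := by rw [← Real.exp_nat_mul]; congr 1; ring
        _ ≤ Real.exp 1 := by
          apply Real.exp_le_exp.2
          rw [div_le_one (by positivity)]; linarith
        _ ≤ 3 := by linarith [Real.exp_one_lt_d9]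
    rw [h1, inv_pow, inv_inv, div_eq_mul_inv, mul_comm]
    gcongr
  · intro r hr
    have := (hasSum_lagPoly_mul_pow hn s hr).mul_right (Complex.exp (-(s / 2)))
    refine this.congr_fun fun k => ?_
    push_cast
    ring
  · intro r hr
    have hne : (1 - r) ≠ 0 := by
      intro h
      have : r = 1 := by linear_combination -h
      simp [this] at hr
      linarith
    rw [mul_assoc, ← Complex.exp_add, norm_mul, norm_inv, norm_pow, Complex.norm_exp]
    have h1 : 1 - ρ ≤ ‖1 - r‖ := by
      have := norm_sub_norm_le (1 : ℂ) r
      simpa [hr] using this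
    have h2 : (-(s * r / (1 - r)) + -(s / 2) : ℂ) = -((s / 2 : ℝ) * ((1 + r) / (1 - r))) := by
      push_cast
      field_simp
      ring
    have h3 : 0 ≤ ((1 + r) / (1 - r)).re := by
      rw [Complex.div_re, ← add_div]
      apply div_nonneg _ (Complex.normSq_nonneg _)
      have h4 : r.re * r.re + r.im * r.im < 1 := by
        rw [← Complex.normSq_apply, Complex.normSq_eq_norm_sq, hr]
        nlinarith
      simp
      nlinarith
    have h5 : Real.exp (-(s * r / (1 - r)) + -(s / 2) : ℂ).re ≤ 1 := by
      rw [h2, Real.exp_le_one_iff, Complex.neg_re, Complex.re_ofReal_mul]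
      have : 0 ≤ s / 2 * ((1 + r) / (1 - r)).re := by positivity
      linarith
    calc _ ≤ (‖1 - r‖ ^ n)⁻¹ * 1 := by gcongr
      _ ≤ _ := by
        rw [mul_one]
        have : 0 < 1 - ρ := by linarith
        gcongr

/-- The polynomial `u ↦ L_k^{n-1}(c u)`. -/
def scaledLaguerre (n k : ℕ) (c : ℝ) : Polynomial ℝ :=
  ∑ j ∈ Finset.range (k + 1),
    Polynomial.monomial j (((k + n - 1).choose (k - j) : ℝ) * (-c) ^ j / j.factorial)

theorem eval_scaledLaguerre (n k : ℕ) (c u : ℝ) :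
    (scaledLaguerre n k c).eval u = lagPoly n k (c * u) := by
  rw [scaledLaguerre, lagPoly, Polynomial.eval_finsetSum]
  refine Finset.sum_congr rfl fun j _ => ?_
  rw [Polynomial.eval_monomial, neg_mul_eq_neg_mul, mul_pow]
  ring

theorem coeff_scaledLaguerre (n k : ℕ) (c : ℝ) (j : ℕ) :
    (scaledLaguerre n k c).coeff j =
      if j ≤ k then ((k + n - 1).choose (k - j) : ℝ) * (-c) ^ j / j.factorial else 0 := by
  simp [scaledLaguerre, Polynomial.coeff_monomial]

theorem coeff_scaledLaguerre_succ {n : ℕ} (hn : 1 ≤ n) (k : ℕ) (c : ℝ) (j : ℕ) :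
    (j + 1) * (j + n) * (scaledLaguerre n k c).coeff (j + 1) =
      c * (j - k) * (scaledLaguerre n k c).coeff j := by
  rw [coeff_scaledLaguerre, coeff_scaledLaguerre]
  rcases lt_trichotomy j k with h | rfl | h
  · rw [if_pos (by omega), if_pos h.le]
    obtain ⟨i, rfl⟩ : ∃ i, k = j + i + 1 := ⟨k - j - 1, by omega⟩
    have h1 : j + i + 1 - j = i + 1 := by omega
    have h2 : j + i + 1 - (j + 1) = i := by omega
    have h3 := Nat.choose_succ_right_eq (j + i + 1 + n - 1) i
    have h4 : j + i + 1 + n - 1 - i = j + n := by omega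
    rw [h4] at h3
    have h5 : ((j + i + 1 + n - 1).choose (i + 1) : ℝ) * (i + 1) =
      (j + i + 1 + n - 1).choose i * (j + n) := by exact_mod_cast h3
    rw [h1, h2, Nat.factorial_succ]
    push_cast
    rw [pow_succ]
    field_simp
    linear_combination (-c * (-c) ^ j) * (-h5)
  · simp
  · rw [if_neg (by omega), if_neg (by omega)]
    simp

/-- The polynomial factor of the derivative of `u ↦ Q(u) e^{-bu}`. -/
def expTwist (b : ℝ) (Q : Polynomial ℝ) : Polynomial ℝ :=
  Polynomial.derivative Q - Polynomial.C b * Q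

theorem hasDerivAt_eval_mul_exp (b : ℝ) (Q : Polynomial ℝ) (u : ℝ) :
    HasDerivAt (fun u => Q.eval u * Real.exp (-(b * u)))
      ((expTwist b Q).eval u * Real.exp (-(b * u))) u := by
  have h1 : HasDerivAt (fun u : ℝ => Real.exp (-(b * u))) (Real.exp (-(b * u)) * (-b)) u := by
    have := ((hasDerivAt_id u).const_mul b).neg.exp
    simpa using this
  refine ((Q.hasDerivAt u).mul h1).congr_deriv ?_
  simp only [expTwist, Polynomial.eval_sub, Polynomial.eval_mul, Polynomial.eval_C]
  ring

theorem scaledLaguerre_ode {n : ℕ} (hn : 1 ≤ n) (k : ℕ) (b u : ℝ) :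
    n * (expTwist b (scaledLaguerre n k (2 * b))).eval u +
        u * (expTwist b (expTwist b (scaledLaguerre n k (2 * b)))).eval u =
      (b ^ 2 * u - b * (2 * k + n)) * (scaledLaguerre n k (2 * b)).eval u := by
  set Q := scaledLaguerre n k (2 * b) with hQ
  have key : Polynomial.X * Polynomial.derivative (Polynomial.derivative Q)
      + Polynomial.C (n : ℝ) * Polynomial.derivative Q
      - Polynomial.C (2 * b) * (Polynomial.X * Polynomial.derivative Q)
      + Polynomial.C (2 * b * k) * Q = 0 := by
    ext j
    have := coeff_scaledLaguerre_succ hn k (2 * b) j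
    rw [← hQ] at this
    cases j with
    | zero =>
      simp [Polynomial.coeff_derivative, -map_mul] at this ⊢
      linear_combination this
    | succ j =>
      simp only [Polynomial.coeff_add, Polynomial.coeff_sub, Polynomial.coeff_C_mul,
        Polynomial.coeff_X_mul, Polynomial.coeff_derivative, Polynomial.coeff_zero] at this ⊢
      push_cast at this ⊢
      linear_combination this
  have := congrArg (Polynomial.eval u) key
  simp only [expTwist, Polynomial.derivative_sub, Polynomial.derivative_mul,
    Polynomial.derivative_C, Polynomial.eval_sub, Polynomial.eval_add, Polynomial.eval_mul,
    Polynomial.eval_C, Polynomial.eval_X, Polynomial.eval_zero] at this ⊢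
  linear_combination this

theorem exists_abs_eval_mul_exp_le {b : ℝ} (hb : 0 < b) (Q : Polynomial ℝ) :
    ∃ C, ∀ u, 0 ≤ u → |Q.eval u * Real.exp (-(b * u))| ≤ C := by
  induction Q using Polynomial.induction_on' with
  | add P Q hP hQ =>
    obtain ⟨C, hC⟩ := hP
    obtain ⟨D, hD⟩ := hQ
    refine ⟨C + D, fun u hu => ?_⟩
    rw [Polynomial.eval_add, add_mul]
    exact (abs_add_le _ _).trans (add_le_add (hC u hu) (hD u hu))
  | monomial i c =>
    refine ⟨|c| * (i.factorial / b ^ i), fun u hu => ?_⟩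
    rw [Polynomial.eval_monomial, mul_assoc, abs_mul]
    gcongr
    rw [abs_of_nonneg (by positivity), Real.exp_neg, ← div_eq_mul_inv,
      div_le_div_iff₀ (Real.exp_pos _) (by positivity)]
    have := Real.pow_div_factorial_le_exp (b * u) (by positivity) i
    rw [div_le_iff₀ (by positivity), mul_pow] at this
    linarith

section Eigen

variable {E : Type*} [NormedAddCommGroup E]

/-- The function `(x, t) ↦ Q(|x|²) e^{-b|x|²} e^{-iλt}`. -/
def gaussChar (b lam : ℝ) (Q : Polynomial ℝ) (p : E × ℝ) : ℂ :=
  ((Q.eval (‖p.1‖ ^ 2) * Real.exp (-(b * ‖p.1‖ ^ 2)) : ℝ) : ℂ) *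
    Complex.exp (-(Complex.I * lam * p.2))

theorem norm_cexp_neg_I_mul (lam t : ℝ) : ‖Complex.exp (-(Complex.I * lam * t))‖ = 1 := by
  rw [Complex.norm_exp]
  simp

theorem norm_gaussChar (b lam : ℝ) (Q : Polynomial ℝ) (p : E × ℝ) :
    ‖gaussChar b lam Q p‖ = |Q.eval (‖p.1‖ ^ 2) * Real.exp (-(b * ‖p.1‖ ^ 2))| := by
  rw [gaussChar, norm_mul, norm_cexp_neg_I_mul, mul_one, Complex.norm_real, Real.norm_eq_abs]

theorem continuous_gaussChar (b lam : ℝ) (Q : Polynomial ℝ) :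
    Continuous (gaussChar b lam Q : E × ℝ → ℂ) := by
  unfold gaussChar
  have := Q.continuous
  fun_prop

variable [InnerProductSpace ℝ E]

theorem hasLineDerivAt_gaussChar (b lam : ℝ) (Q : Polynomial ℝ) (p : E × ℝ) (e : E) :
    HasLineDerivAt ℝ (gaussChar b lam Q)
      (((2 * inner ℝ p.1 e : ℝ) : ℂ) * gaussChar b lam (expTwist b Q) p) p (e, 0) := by
  have h1 : HasDerivAt (fun s : ℝ => ‖p.1 + s • e‖ ^ 2) (2 * inner ℝ p.1 e) 0 := by
    have h : HasDerivAt (fun s : ℝ => p.1 + s • e) e 0 := by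
      simpa using ((hasDerivAt_id (0 : ℝ)).smul_const e).const_add p.1
    simpa using h.norm_sq
  have h2 := (hasDerivAt_eval_mul_exp b Q (‖p.1 + (0 : ℝ) • e‖ ^ 2)).comp 0 h1
  have h3 := h2.ofReal_comp.mul_const (Complex.exp (-(Complex.I * lam * p.2)))
  unfold HasLineDerivAt
  have e1 : (fun s : ℝ => gaussChar b lam Q (p + s • (e, (0 : ℝ)))) = fun s : ℝ =>
      (((fun u => Q.eval u * Real.exp (-(b * u))) ∘ fun s : ℝ => ‖p.1 + s • e‖ ^ 2) s : ℂ) *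
        Complex.exp (-(Complex.I * lam * p.2)) := by
    ext s
    simp [gaussChar]
  rw [e1]
  refine h3.congr_deriv ?_
  simp only [gaussChar, zero_smul, add_zero]
  push_cast
  ring

theorem hasLineDerivAt_inner_mul_gaussChar (b lam : ℝ) (Q : Polynomial ℝ) (p : E × ℝ) (e : E) :
    HasLineDerivAt ℝ (fun p => ((2 * inner ℝ p.1 e : ℝ) : ℂ) * gaussChar b lam Q p)
      (((2 * ‖e‖ ^ 2 : ℝ) : ℂ) * gaussChar b lam Q p +
        ((4 * inner ℝ p.1 e ^ 2 : ℝ) : ℂ) * gaussChar b lam (expTwist b Q) p) p (e, 0) := by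
  have h1 : HasDerivAt (fun s : ℝ => 2 * inner ℝ (p.1 + s • e) e) (2 * ‖e‖ ^ 2) 0 := by
    have h : HasDerivAt (fun s : ℝ => p.1 + s • e) e 0 := by
      simpa using ((hasDerivAt_id (0 : ℝ)).smul_const e).const_add p.1
    simpa using (h.inner ℝ (hasDerivAt_const (0 : ℝ) e)).const_mul 2
  have h2 := h1.ofReal_comp.mul (hasLineDerivAt_gaussChar b lam Q p e)
  unfold HasLineDerivAt
  refine HasDerivAt.congr_deriv (f := fun s : ℝ => ((2 * inner ℝ (p.1 + s • e) e : ℝ) : ℂ) *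
    gaussChar b lam Q (p + s • (e, (0 : ℝ)))) h2 ?_ |>.congr_of_eventuallyEq ?_
  · simp only [zero_smul, add_zero]
    push_cast
    ring
  · refine Eventually.of_forall fun s => ?_
    simp

theorem hasTemperateGrowth_norm_fst_sq (c : ℝ) :
    Function.HasTemperateGrowth (fun p : E × ℝ => c * ‖p.1‖ ^ 2) :=
  (Function.HasTemperateGrowth.const c).mul
    ((Function.hasTemperateGrowth_norm_sq E).comp
      (ContinuousLinearMap.fst ℝ E ℝ).hasTemperateGrowth)

variable [FiniteDimensional ℝ E] [MeasurableSpace E] [BorelSpace E]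
  (μ : Measure (E × ℝ)) [μ.IsAddHaarMeasure]

theorem integrable_norm_pow_mul_mul_gaussChar {b : ℝ} (hb : 0 < b) (lam : ℝ) (Q : Polynomial ℝ)
    (g : SchwartzMap (E × ℝ) ℂ) {h : E × ℝ → ℂ} (hh : Continuous h) (j : ℕ) {C : ℝ}
    (hC : ∀ p, ‖h p‖ ≤ C * ‖p.1‖ ^ j) :
    Integrable (fun p => g p * (h p * gaussChar b lam Q p)) μ := by
  obtain ⟨D, hD⟩ := exists_abs_eval_mul_exp_le hb Q
  have hD0 : 0 ≤ D := (abs_nonneg _).trans (hD 0 le_rfl)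
  have hC0 : ∀ p : E × ℝ, 0 ≤ C * ‖p.1‖ ^ j := fun p => (norm_nonneg _).trans (hC p)
  refine ((g.integrable_pow_mul μ j).const_mul (|C| * D)).mono' ?_ ?_
  · exact (g.continuous.mul (hh.mul (continuous_gaussChar b lam Q))).aestronglyMeasurable
  · refine Eventually.of_forall fun p => ?_
    rw [norm_mul, norm_mul, norm_gaussChar]
    have h1 : ‖h p‖ ≤ |C| * ‖p‖ ^ j := by
      refine (hC p).trans ?_
      gcongr
      · exact le_abs_self C
      · exact norm_fst_le p
    have h2 := hD (‖p.1‖ ^ 2) (by positivity)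
    calc _ ≤ ‖g p‖ * ((|C| * ‖p‖ ^ j) * D) := by gcongr
      _ = _ := by ring

theorem integrable_mul_gaussChar {b : ℝ} (hb : 0 < b) (lam : ℝ) (Q : Polynomial ℝ)
    (g : SchwartzMap (E × ℝ) ℂ) : Integrable (fun p => g p * gaussChar b lam Q p) μ := by
  have := integrable_norm_pow_mul_mul_gaussChar μ hb lam Q g (h := fun _ => 1)
    continuous_const 0 (C := 1) (by simp)
  simpa using this

theorem integrable_mul_inner_mul_gaussChar {b : ℝ} (hb : 0 < b) (lam : ℝ) (Q : Polynomial ℝ)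
    (g : SchwartzMap (E × ℝ) ℂ) (e : E) :
    Integrable (fun p => g p * (((2 * inner ℝ p.1 e : ℝ) : ℂ) * gaussChar b lam Q p)) μ := by
  refine integrable_norm_pow_mul_mul_gaussChar μ hb lam Q g (by fun_prop) 1 (C := 2 * ‖e‖) ?_
  intro p
  rw [Complex.norm_real, norm_mul, Real.norm_eq_abs, Real.norm_eq_abs, abs_two]
  have := abs_real_inner_le_norm p.1 e
  linarith

theorem integrable_mul_inner_sq_mul_gaussChar {b : ℝ} (hb : 0 < b) (lam : ℝ)
    (Q R : Polynomial ℝ) (g : SchwartzMap (E × ℝ) ℂ) (e : E) :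
    Integrable (fun p => g p * (((2 * ‖e‖ ^ 2 : ℝ) : ℂ) * gaussChar b lam Q p +
        ((4 * inner ℝ p.1 e ^ 2 : ℝ) : ℂ) * gaussChar b lam R p)) μ := by
  simp_rw [mul_add]
  refine Integrable.add ?_ ?_
  · exact integrable_norm_pow_mul_mul_gaussChar μ hb lam _ g continuous_const 0
      (C := ‖((2 * ‖e‖ ^ 2 : ℝ) : ℂ)‖) (by simp)
  · refine integrable_norm_pow_mul_mul_gaussChar μ hb lam _ g (by fun_prop) 2
      (C := 4 * ‖e‖ ^ 2) ?_
    intro p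
    have := abs_real_inner_le_norm p.1 e
    rw [Complex.norm_real, Real.norm_eq_abs, abs_mul, abs_pow]
    have h4 : |(4 : ℝ)| = 4 := by norm_num
    rw [h4]
    calc 4 * |inner ℝ p.1 e| ^ 2 ≤ 4 * (‖p.1‖ * ‖e‖) ^ 2 := by gcongr
      _ = _ := by ring

open scoped LineDeriv in
theorem integral_lineDeriv_lineDeriv_mul_gaussChar {b : ℝ} (hb : 0 < b) (lam : ℝ)
    (Q : Polynomial ℝ) (g : SchwartzMap (E × ℝ) ℂ) (e : E) :
    ∫ p, (∂_{((e, 0) : E × ℝ)} (∂_{((e, 0) : E × ℝ)} g)) p * gaussChar b lam Q p ∂μ =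
      ∫ p, g p * (((2 * ‖e‖ ^ 2 : ℝ) : ℂ) * gaussChar b lam (expTwist b Q) p +
        ((4 * inner ℝ p.1 e ^ 2 : ℝ) : ℂ) * gaussChar b lam (expTwist b (expTwist b Q)) p) ∂μ := by
  have ibp : ∀ (g : SchwartzMap (E × ℝ) ℂ) (h h' : E × ℝ → ℂ),
      Integrable (fun p => g p * h p) μ → Integrable (fun p => g p * h' p) μ →
      Integrable (fun p => (∂_{((e, 0) : E × ℝ)} g) p * h p) μ →
      (∀ p, HasLineDerivAt ℝ h (h' p) p (e, 0)) →
      ∫ p, (∂_{((e, 0) : E × ℝ)} g) p * h p ∂μ = -∫ p, g p * h' p ∂μ := by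
    intro g h h' i0 i1 i2 hh
    have hg : ∀ p : E × ℝ, HasLineDerivAt ℝ g ((∂_{((e, 0) : E × ℝ)} g) p) p (e, 0) := by
      intro p
      rw [SchwartzMap.lineDerivOp_apply_eq_fderiv]
      exact (g.hasFDerivAt p).hasLineDerivAt _
    have := integral_bilinear_hasLineDerivAt_right_eq_neg_left_of_integrable (μ := μ)
      (B := ContinuousLinearMap.mul ℝ ℂ) i2 i1 i0 (fun p _ => hg p) (fun p _ => hh p)
    simp only [ContinuousLinearMap.mul_apply'] at this
    rw [this, neg_neg]
  rw [ibp _ _ _ (integrable_mul_gaussChar μ hb lam Q _)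
      (integrable_mul_inner_mul_gaussChar μ hb lam _ _ e) (integrable_mul_gaussChar μ hb lam Q _)
      (fun p => hasLineDerivAt_gaussChar b lam Q p e),
    ibp _ _ _ (integrable_mul_inner_mul_gaussChar μ hb lam _ _ e)
      (integrable_mul_inner_sq_mul_gaussChar μ hb lam _ _ _ e)
      (integrable_mul_inner_mul_gaussChar μ hb lam _ _ e)
      (fun p => hasLineDerivAt_inner_mul_gaussChar b lam _ p e), neg_neg]

open scoped LineDeriv in
/-- The operator `4b²|x|² - Δ_x` on Schwartz functions of `(x, t)`. -/
def oscillator (b : ℝ) (g : SchwartzMap (E × ℝ) ℂ) : SchwartzMap (E × ℝ) ℂ :=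
  SchwartzMap.smulLeftCLM ℂ (fun p : E × ℝ => 4 * b ^ 2 * ‖p.1‖ ^ 2) g -
    ∑ i, ∂_{((stdOrthonormalBasis ℝ E i, 0) : E × ℝ)}
      (∂_{((stdOrthonormalBasis ℝ E i, 0) : E × ℝ)} g)

open scoped LineDeriv in
theorem integral_oscillator_mul_gaussChar {n : ℕ} (hn : 1 ≤ n)
    (hE : Module.finrank ℝ E = 2 * n) {b : ℝ} (hb : 0 < b) (lam : ℝ) (k : ℕ)
    (g : SchwartzMap (E × ℝ) ℂ) :
    ∫ p, oscillator b g p * gaussChar b lam (scaledLaguerre n k (2 * b)) p ∂μ =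
      (4 * b * (2 * k + n) : ℝ) *
        ∫ p, g p * gaussChar b lam (scaledLaguerre n k (2 * b)) p ∂μ := by
  set Q := scaledLaguerre n k (2 * b) with hQ
  set B := stdOrthonormalBasis ℝ E with hB
  have hpt : ∀ p : E × ℝ, oscillator b g p * gaussChar b lam Q p =
      ((SchwartzMap.smulLeftCLM ℂ (fun p : E × ℝ => 4 * b ^ 2 * ‖p.1‖ ^ 2) g) p *
        gaussChar b lam Q p) -
      ∑ i, (∂_{((B i, 0) : E × ℝ)} (∂_{((B i, 0) : E × ℝ)} g)) p * gaussChar b lam Q p := by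
    intro p
    rw [oscillator, sub_apply, sum_apply, sub_mul, Finset.sum_mul]
  simp_rw [hpt]
  rw [integral_sub (integrable_mul_gaussChar μ hb lam Q _)
      (integrable_finsetSum _ fun i _ => integrable_mul_gaussChar μ hb lam Q _),
    integral_finsetSum _ fun i _ => integrable_mul_gaussChar μ hb lam Q _]
  simp_rw [integral_lineDeriv_lineDeriv_mul_gaussChar μ hb lam Q g]
  rw [← integral_finsetSum _ fun i _ => integrable_mul_inner_sq_mul_gaussChar μ hb lam _ _ g _,
    ← integral_sub (integrable_mul_gaussChar μ hb lam Q _)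
      (integrable_finsetSum _ fun i _ => integrable_mul_inner_sq_mul_gaussChar μ hb lam _ _ g _),
    ← integral_const_mul]
  refine integral_congr_ae (Eventually.of_forall fun p => ?_)
  have hsum : ∑ i, inner ℝ p.1 (B i) ^ 2 = ‖p.1‖ ^ 2 := B.sum_sq_inner_left p.1
  have hode := scaledLaguerre_ode hn k b (‖p.1‖ ^ 2)
  rw [← hQ] at hode
  have hode' : (n * (((expTwist b Q).eval (‖p.1‖ ^ 2) : ℝ) : ℂ) +
      (‖p.1‖ : ℂ) ^ 2 * (((expTwist b (expTwist b Q)).eval (‖p.1‖ ^ 2) : ℝ) : ℂ)) =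
      (b ^ 2 * (‖p.1‖ : ℂ) ^ 2 - b * (2 * k + n)) * ((Q.eval (‖p.1‖ ^ 2) : ℝ) : ℂ) := by
    exact_mod_cast hode
  simp only [B.norm_eq_one]
  rw [SchwartzMap.smulLeftCLM_apply_apply (hasTemperateGrowth_norm_fst_sq _), ← Finset.mul_sum,
    Finset.sum_add_distrib, ← Finset.sum_mul, ← Finset.sum_mul, ← Complex.ofReal_sum,
    ← Complex.ofReal_sum, ← Finset.mul_sum, ← Finset.mul_sum, hsum]
  simp only [Finset.sum_const, Finset.card_univ, Fintype.card_fin, hE, Complex.real_smul, gaussChar]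
  push_cast
  simp only [nsmul_eq_mul]
  push_cast
  linear_combination (-4 * g p * Complex.exp (-(b * (‖p.1‖ : ℂ) ^ 2)) *
    Complex.exp (-(Complex.I * lam * p.2))) * hode'

end Eigen

theorem abs_lagPoly_two_mul_exp_le {n : ℕ} (hn : 1 ≤ n) (k : ℕ) {b u : ℝ} (hb : 0 < b)
    (hu : 0 ≤ u) : |lagPoly n k (2 * b * u) * Real.exp (-(b * u))| ≤ 3 * (k + 2) ^ n := by
  have := abs_lagPoly_mul_exp_le hn k (s := 2 * b * u) (by positivity)
  rwa [show 2 * b * u / 2 = b * u by ring] at this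

section Summability

variable {E : Type*} [NormedAddCommGroup E] [InnerProductSpace ℝ E]
  [FiniteDimensional ℝ E] [MeasurableSpace E] [BorelSpace E]
  (μ : Measure (E × ℝ)) [μ.IsAddHaarMeasure]

theorem integral_iterate_oscillator_mul_gaussChar {n : ℕ} (hn : 1 ≤ n)
    (hE : Module.finrank ℝ E = 2 * n) {b : ℝ} (hb : 0 < b) (lam : ℝ) (k m : ℕ)
    (g : SchwartzMap (E × ℝ) ℂ) :
    ∫ p, ((oscillator b)^[m] g) p * gaussChar b lam (scaledLaguerre n k (2 * b)) p ∂μ =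
      ((4 * b * (2 * k + n) : ℝ) : ℂ) ^ m *
        ∫ p, g p * gaussChar b lam (scaledLaguerre n k (2 * b)) p ∂μ := by
  induction m with
  | zero => simp
  | succ m ih =>
    rw [Function.iterate_succ_apply', integral_oscillator_mul_gaussChar μ hn hE hb, ih, pow_succ']
    push_cast
    ring

theorem norm_integral_mul_gaussChar_le {n : ℕ} (hn : 1 ≤ n) {b : ℝ} (hb : 0 < b) (lam : ℝ)
    (k : ℕ) (g : SchwartzMap (E × ℝ) ℂ) :
    ‖∫ p, g p * gaussChar b lam (scaledLaguerre n k (2 * b)) p ∂μ‖ ≤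
      3 * (k + 2) ^ n * ∫ p, ‖g p‖ ∂μ := by
  rw [← integral_const_mul]
  refine norm_integral_le_of_norm_le (g.integrable.norm.const_mul _)
    (Eventually.of_forall fun p => ?_)
  rw [norm_mul, mul_comm, norm_gaussChar, eval_scaledLaguerre]
  gcongr
  exact abs_lagPoly_two_mul_exp_le hn k hb (by positivity)

theorem summable_integral_mul_gaussChar {n : ℕ} (hn : 1 ≤ n)
    (hE : Module.finrank ℝ E = 2 * n) {b : ℝ} (hb : 0 < b) (lam : ℝ)
    (g : SchwartzMap (E × ℝ) ℂ) :
    Summable fun k : ℕ => ∫ p, g p * gaussChar b lam (scaledLaguerre n k (2 * b)) p ∂μ := by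
  set I := ∫ p, ‖((oscillator b)^[n + 2] g) p‖ ∂μ with hI
  have hI0 : 0 ≤ I := integral_nonneg fun _ => norm_nonneg _
  have hs : Summable fun k : ℕ => 3 * I / (2 * b) ^ (n + 2) * (1 / ((k + 2 : ℕ) : ℝ) ^ 2) :=
    (((summable_nat_add_iff 2).2 (Real.summable_one_div_nat_pow.2 one_lt_two))).mul_left _
  refine Summable.of_norm_bounded hs fun k => ?_
  have h1 := integral_iterate_oscillator_mul_gaussChar μ hn hE hb lam k (n + 2) g
  have h2 := norm_integral_mul_gaussChar_le μ hn hb lam k ((oscillator b)^[n + 2] g)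
  rw [h1, norm_mul, norm_pow, Complex.norm_real, Real.norm_eq_abs, ← hI] at h2
  have hn' : (1 : ℝ) ≤ n := by exact_mod_cast hn
  have hk : (0 : ℝ) ≤ k := k.cast_nonneg
  have h3 : 2 * b * (k + 2) ≤ |4 * b * (2 * k + n)| := by
    rw [abs_of_nonneg (by positivity)]
    nlinarith
  set c := ‖∫ p, g p * gaussChar b lam (scaledLaguerre n k (2 * b)) p ∂μ‖
  have h4 : (2 * b * (k + 2)) ^ (n + 2) * c ≤ 3 * (k + 2) ^ n * I :=
    le_trans (by gcongr) h2
  push_cast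
  rw [div_mul_div_comm, le_div_iff₀ (by positivity)]
  have h5 : (0 : ℝ) < (k + 2) ^ n := by positivity
  refine le_of_mul_le_mul_left ?_ h5
  calc ((k : ℝ) + 2) ^ n * (c * ((2 * b) ^ (n + 2) * (k + 2) ^ 2))
      = (2 * b * (k + 2)) ^ (n + 2) * c := by
        rw [mul_pow (2 * b) ((k : ℝ) + 2), pow_add ((k : ℝ) + 2)]
        ring
    _ ≤ _ := h4
    _ = _ := by ring

end Summability

section Abel

variable {E : Type*} [NormedAddCommGroup E] [InnerProductSpace ℝ E]
  [FiniteDimensional ℝ E] [MeasurableSpace E] [BorelSpace E]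

theorem hasSum_lagPoly_mul_exp_mul_pow {n : ℕ} (hn : 1 ≤ n) (b u : ℝ) {r : ℝ} (hr0 : 0 ≤ r)
    (hr : r < 1) :
    HasSum (fun k => ((lagPoly n k (2 * b * u) * Real.exp (-(b * u)) : ℝ) : ℂ) * (r : ℂ) ^ k)
      ((((1 - r) ^ n)⁻¹ * Real.exp (-(b * u * (1 + r) / (1 - r))) : ℝ) : ℂ) := by
  have h1 : ‖(r : ℂ)‖ < 1 := by rwa [Complex.norm_real, Real.norm_eq_abs, abs_of_nonneg hr0]
  have h := (hasSum_lagPoly_mul_pow hn (2 * b * u) h1).mul_right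
    ((Real.exp (-(b * u)) : ℝ) : ℂ)
  convert! h using 1
  · ext k
    push_cast
    ring
  · push_cast
    rw [mul_assoc (_⁻¹), ← Complex.exp_add]
    congr 2
    have : (1 - r : ℂ) ≠ 0 := by
      have : (1 - r : ℝ) ≠ 0 := by linarith
      exact_mod_cast this
    field_simp
    ring

theorem hasSum_pow_mul_integral_lagPoly {n : ℕ} (hn : 1 ≤ n) {b : ℝ} (hb : 0 < b) {G : E → ℂ}
    (hGi : Integrable G) {r : ℝ} (hr0 : 0 ≤ r) (hr : r < 1) :
    HasSum (fun k : ℕ => (∫ x, G x * ((lagPoly n k (2 * b * ‖x‖ ^ 2) *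
        Real.exp (-(b * ‖x‖ ^ 2)) : ℝ) : ℂ)) * (r : ℂ) ^ k)
      (∫ x, G x * ((((1 - r) ^ n)⁻¹ *
        Real.exp (-(b * ‖x‖ ^ 2 * (1 + r) / (1 - r))) : ℝ) : ℂ)) := by
  have hpoly : ∀ k, Continuous (lagPoly n k) := fun k => by unfold lagPoly; fun_prop
  have hs : Summable fun k : ℕ => 3 * ((k : ℝ) + 2) ^ n * r ^ k := by
    have h := summable_pow_mul_geometric_of_norm_lt_one n
      (show ‖r‖ < 1 by rwa [Real.norm_eq_abs, abs_of_nonneg hr0])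
    have h0 := summable_geometric_of_lt_one hr0 hr
    refine Summable.of_nonneg_of_le (fun k => by positivity) (fun k => ?_)
      ((h.mul_left (3 * 3 ^ n)).add (h0.mul_left (3 * 2 ^ n)))
    rcases Nat.eq_zero_or_pos k with rfl | hk
    · simp
    · have hk' : (1 : ℝ) ≤ k := by exact_mod_cast hk
      have : ((k : ℝ) + 2) ^ n ≤ 3 ^ n * k ^ n := by
        rw [← mul_pow]
        gcongr
        linarith
      have h2 : 0 ≤ 3 * 2 ^ n * r ^ k := by positivity
      calc _ ≤ 3 * (3 ^ n * (k : ℝ) ^ n) * r ^ k := by gcongr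
        _ ≤ _ := by linarith
  simp_rw [← integral_mul_const]
  refine hasSum_integral_of_dominated_convergence
    (fun k x => ‖G x‖ * (3 * ((k : ℝ) + 2) ^ n * r ^ k)) ?_ ?_ ?_ ?_ ?_
  · intro k
    have := hpoly k
    refine (hGi.aestronglyMeasurable.mul ?_).mul_const _
    exact Continuous.aestronglyMeasurable (by fun_prop)
  · intro k
    refine Eventually.of_forall fun x => ?_
    rw [norm_mul, norm_mul, norm_pow, Complex.norm_real, Complex.norm_real, Real.norm_eq_abs,
      Real.norm_eq_abs, abs_of_nonneg hr0, mul_assoc]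
    gcongr
    exact abs_lagPoly_two_mul_exp_le hn k hb (by positivity)
  · exact Eventually.of_forall fun x => hs.mul_left _
  · simp_rw [tsum_mul_left]
    exact hGi.norm.mul_const _
  · refine Eventually.of_forall fun x => ?_
    simp_rw [mul_assoc (G x)]
    exact (hasSum_lagPoly_mul_exp_mul_pow hn b (‖x‖ ^ 2) hr0 hr).mul_left _

theorem integral_mul_gaussian_eq_dilate {n : ℕ} (hE : Module.finrank ℝ E = 2 * n) (b : ℝ)
    (G : E → ℂ) {r : ℝ} (hr : r < 1) :
    ∫ x, G x * ((((1 - r) ^ n)⁻¹ * Real.exp (-(b * ‖x‖ ^ 2 * (1 + r) / (1 - r))) : ℝ) : ℂ) =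
      ∫ x, G (√(1 - r) • x) * ((Real.exp (-(b * (1 + r) * ‖x‖ ^ 2)) : ℝ) : ℂ) := by
  have h1 : 0 < 1 - r := by linarith
  have h := Measure.integral_comp_smul_of_nonneg (volume : Measure E) (fun x => G x *
    ((Real.exp (-(b * ‖x‖ ^ 2 * (1 + r) / (1 - r))) : ℝ) : ℂ)) (√(1 - r)) (hR := Real.sqrt_nonneg _)
  rw [hE, pow_mul, Real.sq_sqrt h1.le, ← integral_smul] at h
  convert! h.symm using 1
  · congr 1
    ext x
    rw [Complex.real_smul]
    push_cast
    ring
  · congr 1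
    ext x
    rw [norm_smul, mul_pow, Real.norm_eq_abs, sq_abs, Real.sq_sqrt h1.le]
    congr 3
    field_simp

theorem integrable_exp_neg_mul_norm_sq {b : ℝ} (hb : 0 < b) :
    Integrable fun x : E => Real.exp (-(b * ‖x‖ ^ 2)) := by
  have h := (GaussianFourier.integrable_cexp_neg_mul_sq_norm_add (V := E) (b := (b : ℂ))
    (by simpa using hb) 0 0).norm
  refine h.congr (Eventually.of_forall fun x => ?_)
  simp only [Complex.norm_exp]
  simp [← Complex.ofReal_pow]

theorem tendsto_integral_dilate_mul_gaussian {b : ℝ} (hb : 0 < b) {G : E → ℂ}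
    (hGc : Continuous G) {M : ℝ} (hM : ∀ x, ‖G x‖ ≤ M) :
    Tendsto (fun r : ℝ => ∫ x, G (√(1 - r) • x) *
        ((Real.exp (-(b * (1 + r) * ‖x‖ ^ 2)) : ℝ) : ℂ)) (nhdsWithin 1 (Set.Iio 1))
      (nhds (∫ x : E, G 0 * ((Real.exp (-(b * 2 * ‖x‖ ^ 2)) : ℝ) : ℂ))) := by
  refine tendsto_integral_filter_of_dominated_convergence
    (fun x => M * Real.exp (-(b * ‖x‖ ^ 2))) ?_ ?_ ?_ ?_
  · exact Eventually.of_forall fun r => Continuous.aestronglyMeasurable (by fun_prop)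
  · have : Set.Ioo (0 : ℝ) 1 ∈ nhdsWithin (1 : ℝ) (Set.Iio 1) := Ioo_mem_nhdsLT one_pos
    filter_upwards [this] with r hr
    refine Eventually.of_forall fun x => ?_
    rw [norm_mul, Complex.norm_real, Real.norm_eq_abs, abs_of_pos (Real.exp_pos _)]
    gcongr
    · exact (norm_nonneg _).trans (hM 0)
    · exact hM _
    · nlinarith [hr.1]
  · exact (integrable_exp_neg_mul_norm_sq hb).const_mul M
  · refine Eventually.of_forall fun x => ?_
    have hc : Continuous fun r : ℝ => G (√(1 - r) • x) *
        ((Real.exp (-(b * (1 + r) * ‖x‖ ^ 2)) : ℝ) : ℂ) := by fun_prop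
    have := hc.tendsto 1
    simp only [sub_self, Real.sqrt_zero, zero_smul, one_add_one_eq_two] at this
    exact this.mono_left nhdsWithin_le_nhds

/-- The sum of the Laguerre coefficients of `G` is a multiple of `G 0`. -/
theorem tsum_integral_lagPoly {n : ℕ} (hn : 1 ≤ n) (hE : Module.finrank ℝ E = 2 * n) {b : ℝ}
    (hb : 0 < b) {G : E → ℂ} (hGc : Continuous G) {M : ℝ} (hM : ∀ x, ‖G x‖ ≤ M)
    (hGi : Integrable G)
    (hs : Summable fun k : ℕ => ∫ x, G x * ((lagPoly n k (2 * b * ‖x‖ ^ 2) *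
        Real.exp (-(b * ‖x‖ ^ 2)) : ℝ) : ℂ)) :
    ∑' k : ℕ, ∫ x, G x * ((lagPoly n k (2 * b * ‖x‖ ^ 2) *
        Real.exp (-(b * ‖x‖ ^ 2)) : ℝ) : ℂ) = ((π / (2 * b)) ^ n : ℝ) * G 0 := by
  have h1 := Complex.tendsto_tsum_powerSeries_nhdsWithin_lt hs.hasSum.tendsto_sum_nat
  rw [tendsto_map'_iff] at h1
  refine tendsto_nhds_unique h1 ?_
  have h2 := tendsto_integral_dilate_mul_gaussian hb hGc hM
  have h3 : ∫ x : E, G 0 * ((Real.exp (-(b * 2 * ‖x‖ ^ 2)) : ℝ) : ℂ) =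
      ((π / (2 * b)) ^ n : ℝ) * G 0 := by
    rw [integral_const_mul, integral_complex_ofReal, mul_comm]
    have := GaussianFourier.integral_rexp_neg_mul_sq_norm (V := E) (b := 2 * b) (by positivity)
    rw [hE] at this
    push_cast at this
    rw [mul_div_cancel_left₀ _ (two_ne_zero' ℝ), Real.rpow_natCast] at this
    rw [← this]
    simp_rw [neg_mul, mul_comm b 2]
  rw [h3] at h2
  refine h2.congr' ?_
  have : Set.Ioo (0 : ℝ) 1 ∈ nhdsWithin (1 : ℝ) (Set.Iio 1) := Ioo_mem_nhdsLT one_pos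
  filter_upwards [this] with r hr
  rw [← integral_mul_gaussian_eq_dilate hE b G hr.2]
  exact (hasSum_pow_mul_integral_lagPoly hn hb hGi hr.1.le hr.2).tsum_eq.symm

end Abel

section PartialFourier

variable {E : Type*} [NormedAddCommGroup E] [InnerProductSpace ℝ E]

theorem exists_norm_le_inv_one_add_sq (g : SchwartzMap (E × ℝ) ℂ) :
    ∃ C, ∀ x s, ‖g (x, s)‖ ≤ C * (1 + s ^ 2)⁻¹ := by
  obtain ⟨C, -, hC⟩ := g.decay 0 0
  obtain ⟨D, -, hD⟩ := g.decay 2 0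
  refine ⟨C + D, fun x s => ?_⟩
  have h1 := hC (x, s)
  have h2 := hD (x, s)
  rw [norm_iteratedFDeriv_zero] at h1 h2
  rw [pow_zero, one_mul] at h1
  have h3 : s ^ 2 ≤ ‖(x, s)‖ ^ 2 := by
    rw [← sq_abs, ← Real.norm_eq_abs]
    gcongr
    exact norm_snd_le (x, s)
  rw [← div_eq_mul_inv, le_div_iff₀ (by positivity)]
  nlinarith [norm_nonneg (g (x, s))]

/-- The partial Fourier transform `∫ e^{-iλs} g(x, s) ds`. -/
def partialFourier (lam : ℝ) (g : E × ℝ → ℂ) (x : E) : ℂ :=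
  ∫ s : ℝ, Complex.exp (-(Complex.I * lam * s)) * g (x, s)

theorem continuous_partialFourier (lam : ℝ) (g : SchwartzMap (E × ℝ) ℂ) :
    Continuous (partialFourier lam g) := by
  obtain ⟨C, hC⟩ := exists_norm_le_inv_one_add_sq g
  have hg := g.continuous
  refine continuous_of_dominated (bound := fun s => C * (1 + s ^ 2)⁻¹) ?_ ?_
    (integrable_inv_one_add_sq.const_mul C) ?_
  · exact fun x => Continuous.aestronglyMeasurable (by fun_prop)
  · refine fun x => Eventually.of_forall fun s => ?_
    rw [norm_mul, norm_cexp_neg_I_mul, one_mul]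
    exact hC x s
  · exact Eventually.of_forall fun s => by fun_prop

theorem exists_norm_partialFourier_le (lam : ℝ) (g : SchwartzMap (E × ℝ) ℂ) :
    ∃ M, ∀ x, ‖partialFourier lam g x‖ ≤ M := by
  obtain ⟨C, hC⟩ := exists_norm_le_inv_one_add_sq g
  refine ⟨∫ s : ℝ, C * (1 + s ^ 2)⁻¹, fun x => ?_⟩
  refine norm_integral_le_of_norm_le (integrable_inv_one_add_sq.const_mul C)
    (Eventually.of_forall fun s => ?_)
  rw [norm_mul, norm_cexp_neg_I_mul, one_mul]
  exact hC x s

variable [FiniteDimensional ℝ E] [MeasurableSpace E] [BorelSpace E]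

theorem integrable_partialFourier (lam : ℝ) (g : SchwartzMap (E × ℝ) ℂ) :
    Integrable (partialFourier lam g) := by
  have hg : Integrable g ((volume : Measure E).prod volume) := g.integrable
  have h : Integrable (fun p : E × ℝ => Complex.exp (-(Complex.I * lam * p.2)) * g p)
      ((volume : Measure E).prod volume) := by
    refine hg.bdd_mul (c := 1) (Continuous.aestronglyMeasurable (by fun_prop))
      (Eventually.of_forall fun p => (norm_cexp_neg_I_mul lam p.2).le)
  exact h.integral_prod_left

theorem integral_partialFourier_mul {b : ℝ} (hb : 0 < b) (lam : ℝ) (n k : ℕ)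
    (g : SchwartzMap (E × ℝ) ℂ) :
    ∫ x, partialFourier lam g x * ((lagPoly n k (2 * b * ‖x‖ ^ 2) *
        Real.exp (-(b * ‖x‖ ^ 2)) : ℝ) : ℂ) =
      ∫ p, g p * gaussChar b lam (scaledLaguerre n k (2 * b)) p
        ∂((volume : Measure E).prod volume) := by
  rw [integral_prod _ (integrable_mul_gaussChar _ hb lam _ g)]
  refine integral_congr_ae (Eventually.of_forall fun x => ?_)
  simp only [partialFourier, gaussChar, eval_scaledLaguerre]
  rw [← integral_mul_const]
  refine integral_congr_ae (Eventually.of_forall fun s => ?_)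
  ring

theorem tsum_integral_partialFourier_mul {n : ℕ} (hn : 1 ≤ n)
    (hE : Module.finrank ℝ E = 2 * n) {b : ℝ} (hb : 0 < b) (lam : ℝ)
    (g : SchwartzMap (E × ℝ) ℂ) :
    ∑' k : ℕ, ∫ x, partialFourier lam g x * ((lagPoly n k (2 * b * ‖x‖ ^ 2) *
        Real.exp (-(b * ‖x‖ ^ 2)) : ℝ) : ℂ) =
      ((π / (2 * b)) ^ n : ℝ) * partialFourier lam g 0 := by
  obtain ⟨M, hM⟩ := exists_norm_partialFourier_le lam g
  refine tsum_integral_lagPoly hn hE hb (continuous_partialFourier lam g) hM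
    (integrable_partialFourier lam g) ?_
  simp_rw [integral_partialFourier_mul hb lam n _ g]
  exact summable_integral_mul_gaussChar _ hn hE hb lam g

end PartialFourier

/-- The form `w ↦ Im (z · w̄)` as a real-linear map. -/
def imZWLinear {n : ℕ} (z : Cn n) : Cn n →ₗ[ℝ] ℝ where
  toFun := imZW z
  map_add' v w := by simp [imZW, mul_add, Finset.sum_add_distrib]
  map_smul' c w := by
    simp [imZW, Finset.mul_sum]
    refine Finset.sum_congr rfl fun j _ => ?_
    ring

/-- The linear involution `(w, s) ↦ (-w, s - Im (z · w̄) / 2)`. -/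
def heisenbergShear {n : ℕ} (z : Cn n) : Hn n ≃L[ℝ] Hn n :=
  (LinearEquiv.ofInvolutive
    (LinearMap.prod (-LinearMap.fst ℝ (Cn n) ℝ)
      (LinearMap.snd ℝ (Cn n) ℝ - (1 / 2 : ℝ) • (imZWLinear z).comp (LinearMap.fst ℝ (Cn n) ℝ)))
    (fun p => by ext <;> simp)).toContinuousLinearEquiv

theorem heisenbergShear_apply {n : ℕ} (z : Cn n) (p : Hn n) :
    heisenbergShear z p = (-p.1, p.2 - imZW z p.1 / 2) := by
  change (-p.1, p.2 - (1 / 2 : ℝ) • imZW z p.1) = _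
  rw [smul_eq_mul]
  congr 2
  ring

/-- The function `(w, s) ↦ f(z - w, s - Im (z · w̄) / 2)`. -/
def heisenbergTranslate {n : ℕ} (f : SchwartzMap (Hn n) ℂ) (z : Cn n) : SchwartzMap (Hn n) ℂ :=
  SchwartzMap.compCLMOfContinuousLinearEquiv ℂ (heisenbergShear z)
    (SchwartzMap.compSubConstCLM ℂ ((-z, 0) : Hn n) f)

theorem heisenbergTranslate_apply {n : ℕ} (f : SchwartzMap (Hn n) ℂ) (z w : Cn n) (s : ℝ) :
    heisenbergTranslate f z (w, s) = f (z - w, s - imZW z w / 2) := by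
  change f (heisenbergShear z (w, s) - (-z, 0)) = _
  rw [heisenbergShear_apply]
  congr 1
  ext1
  · simp [sub_eq_add_neg, add_comm]
  · simp

theorem partialFourier_heisenbergTranslate {n : ℕ} (f : SchwartzMap (Hn n) ℂ) (z w : Cn n)
    (lam : ℝ) :
    partialFourier lam (heisenbergTranslate f z) w =
      fLam n f (-lam) (z - w) *
        Complex.exp (Complex.I / 2 * ((-lam : ℝ) : ℂ) * ((imZW z w : ℝ) : ℂ)) := by
  rw [partialFourier, fLam, ← integral_mul_const]
  simp_rw [heisenbergTranslate_apply]
  rw [← integral_sub_right_eq_self (fun t : ℝ => Complex.exp (Complex.I * ((-lam : ℝ) : ℂ) * t) *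
    f (z - w, t) * Complex.exp (Complex.I / 2 * ((-lam : ℝ) : ℂ) * ((imZW z w : ℝ) : ℂ)))
    (imZW z w / 2)]
  refine integral_congr_ae (Eventually.of_forall fun s => ?_)
  dsimp only
  rw [mul_right_comm _ (f _), ← Complex.exp_add]
  congr 2
  push_cast
  ring

theorem tsum_stri {n : ℕ} (hn : 1 ≤ n) (f : SchwartzMap (Hn n) ℂ) (z : Cn n) {lam : ℝ}
    (hlam : lam ≠ 0) :
    ∑' k : ℕ, stri n f k lam z = ((2 * π / |lam|) ^ n : ℝ) * fLam n f (-lam) z := by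
  have hpos : 0 < |lam| := abs_pos.2 hlam
  have hE : Module.finrank ℝ (Cn n) = 2 * n := by
    rw [finrank_real_of_complex, finrank_euclideanSpace_fin]
  have h := tsum_integral_partialFourier_mul hn hE (b := |lam| / 4) (by positivity) lam
    (heisenbergTranslate f z)
  have h0 : partialFourier lam (heisenbergTranslate f z) 0 = fLam n f (-lam) z := by
    rw [partialFourier_heisenbergTranslate]
    simp [imZW]
  rw [h0, show π / (2 * (|lam| / 4)) = 2 * π / |lam| by field_simp; ring] at h
  rw [← h]
  refine tsum_congr fun k => integral_congr_ae (Eventually.of_forall fun w => ?_)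
  simp only [lagFun, partialFourier_heisenbergTranslate]
  rw [mul_right_comm]
  congr 4
  · ring
  · congr 1
    ring

theorem integral_exp_mul_fLam {n : ℕ} (f : SchwartzMap (Hn n) ℂ) (z : Cn n) (t : ℝ) :
    ∫ lam : ℝ, Complex.exp (Complex.I * lam * t) * fLam n f (-lam) z =
      ((2 * π : ℝ) : ℂ) * f (z, t) := by
  have hT : Function.HasTemperateGrowth (fun s : ℝ => ((z, s) : Hn n)) := by
    convert! (ContinuousLinearMap.inr ℝ (Cn n) ℝ).hasTemperateGrowth.add
      (Function.HasTemperateGrowth.const ((z, 0) : Hn n)) using 1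
    ext s <;> simp
  have hA : AntilipschitzWith 1 (fun s : ℝ => ((z, s) : Hn n)) := by
    refine AntilipschitzWith.of_le_mul_dist fun x y => ?_
    simp [Prod.dist_eq]
  set h : SchwartzMap ℝ ℂ := SchwartzMap.compCLMOfAntilipschitz ℂ hT hA f with hh
  have happ : ∀ s, h s = f (z, s) := fun s => rfl
  have hinv := congrFun (h.continuous.fourierInv_fourier_eq h.integrable
    (FourierTransform.fourier h : SchwartzMap ℝ ℂ).integrable) t
  rw [← happ, ← hinv, Real.fourierInv_eq']
  have hc := Measure.integral_comp_mul_left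
    (fun lam : ℝ => Complex.exp (Complex.I * lam * t) * fLam n f (-lam) z) (2 * π)
  rw [abs_of_pos (by positivity), eq_inv_smul_iff₀ (by positivity), Complex.real_smul] at hc
  rw [← hc]
  congr 1
  refine integral_congr_ae (Eventually.of_forall fun ξ => ?_)
  dsimp only
  rw [Real.fourier_eq', fLam, smul_eq_mul]
  congr 1
  · congr 1
    simp
    ring
  · refine integral_congr_ae (Eventually.of_forall fun s => ?_)
    dsimp only
    rw [smul_eq_mul, happ]
    congr 2
    simp
    ring

/-- Inversion formula in spectral form:
f(z,t) = (2π)^{−n−1} ∫_ℝ e^{iλt} (∑_k f̂((λ,(2k+n)|λ|),z)) |λ|^n dλ for Schwartz f. -/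
theorem strichartz_inversion_spectral (n : ℕ) (hn : 1 ≤ n) (f : SchwartzMap (Hn n) ℂ)
    (z : Cn n) (t : ℝ) :
    f (z, t) = ((((2 * π) ^ (n + 1))⁻¹ : ℝ) : ℂ) *
      ∫ lam : ℝ, Complex.exp (Complex.I * (lam : ℂ) * (t : ℂ)) *
        (∑' k : ℕ, stri n (⇑f) k lam z) * ((|lam| ^ n : ℝ) : ℂ) := by
  have hspec : ∫ lam : ℝ, Complex.exp (Complex.I * (lam : ℂ) * (t : ℂ)) *
        (∑' k : ℕ, stri n (⇑f) k lam z) * ((|lam| ^ n : ℝ) : ℂ) =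
      (((2 * π) ^ n : ℝ) : ℂ) *
        ∫ lam : ℝ, Complex.exp (Complex.I * lam * t) * fLam n f (-lam) z := by
    rw [← integral_const_mul]
    refine integral_congr_ae ?_
    have h0 : ∀ᵐ lam : ℝ, lam ≠ 0 := by simp [ae_iff]
    filter_upwards [h0] with lam hlam
    rw [tsum_stri hn f z hlam]
    have hne : ((|lam| : ℝ) : ℂ) ≠ 0 := by exact_mod_cast abs_ne_zero.2 hlam
    push_cast
    rw [div_pow]
    field_simp
  rw [hspec, integral_exp_mul_fLam]
  have hpi : ((π : ℝ) : ℂ) ≠ 0 := by exact_mod_cast Real.pi_ne_zero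
  push_cast
  rw [pow_succ]
  field_simp
end
end
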